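/- arXiv:1509.00752 — 2 statements merged into one kernel-verified Lean document; each statement's English description precedes it below -/
import Mathlib

section
/- Over a field K of characteristic 0, the rational function φ_t(x) = (x − t)/(x³ + 1) (with parameter t ≠ −1) has second iterate φ_t² whose numerator and denominator (degree-9 polynomials in x) have resultant equal to (t+1)¹²·(t²−t+1)¹². In particular, for every t ≠ −1 the second iterate φ_t² is not a polynomial. -/
open Polynomial

/-- The Sylvester matrix of two univariate polynomials of degree (at most) `d`. -/
noncomputable def sylvesterMatrixU {R : Type*} [CommRing R] (d : ℕ)
    (f g : Polynomial R) : Matrix (Fin (2 * d)) (Fin (2 * d)) R :=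
  Matrix.of fun i j =>
    if (i : ℕ) < d then
      (if (i : ℕ) ≤ (j : ℕ) ∧ (j : ℕ) ≤ (i : ℕ) + d then
        f.coeff (d - ((j : ℕ) - (i : ℕ))) else 0)
    else
      (if (i : ℕ) - d ≤ (j : ℕ) ∧ (j : ℕ) ≤ (i : ℕ) then
        g.coeff (d - ((j : ℕ) - ((i : ℕ) - d))) else 0)

/-- The resultant of two univariate polynomials of degree `d`, as the determinant
of their Sylvester matrix. -/
noncomputable def resultantU {R : Type*} [CommRing R] (d : ℕ)
    (f g : Polynomial R) : R :=
  (sylvesterMatrixU d f g).det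

lemma resultantU_eq {R : Type*} [CommRing R] (f g : Polynomial R) :
    resultantU 9 f g = resultant f g 9 9 := by
  have h : sylvesterMatrixU 9 f g
      = ((sylvester f g 9 9).submatrix (Fin.revPerm (n := 18)) (Fin.revPerm (n := 18))).transpose := by
    ext i j
    obtain ⟨i, hi⟩ := i
    obtain ⟨j, hj⟩ := j
    simp only [Matrix.transpose_apply, Matrix.submatrix_apply, sylvesterMatrixU, sylvester,
      Matrix.of_apply, Fin.revPerm_apply]
    by_cases h9 : i < 9
    · have e : (Fin.rev (n := 18) ⟨i, hi⟩) = Fin.natAdd 9 (⟨8 - i, by omega⟩ : Fin 9) := by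
        ext; simp; omega
      rw [e, Fin.addCases_right]
      simp only [Fin.val_rev, Set.mem_Icc, if_pos h9]
      apply ite_congr
      · apply propext; omega
      · intro h; congr 1; omega
      · intro h; rfl
    · have e : (Fin.rev (n := 18) ⟨i, hi⟩) = Fin.castAdd 9 (⟨17 - i, by omega⟩ : Fin 9) := by
        ext; simp
      rw [e, Fin.addCases_left]
      simp only [Fin.val_rev, Set.mem_Icc, if_neg h9]
      apply ite_congr
      · apply propext; omega
      · intro h; congr 1; omega
      · intro h; rfl
  unfold resultantU resultant
  rw [h, Matrix.det_transpose]
  exact Matrix.det_submatrix_equiv_self _ _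

lemma res_mul_left {R : Type*} [CommRing R] (f₁ f₂ g : Polynomial R) (m₁ m₂ n : ℕ)
    (h₁ : f₁.natDegree ≤ m₁) (h₂ : f₂.natDegree ≤ m₂) (hn : g.natDegree ≤ n) :
    resultant (f₁ * f₂) g (m₁ + m₂) n = resultant f₁ g m₁ n * resultant f₂ g m₂ n := by
  obtain ⟨a, rfl⟩ := Nat.exists_eq_add_of_le h₁
  obtain ⟨b, rfl⟩ := Nat.exists_eq_add_of_le h₂
  rw [show f₁.natDegree + a + (f₂.natDegree + b) = f₁.natDegree + f₂.natDegree + (a + b) by ring,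
    resultant_add_left_deg _ _ _ _ _ natDegree_mul_le, resultant_mul_left _ _ _ _ hn,
    resultant_add_left_deg _ _ _ _ _ le_rfl, resultant_add_left_deg _ _ _ _ _ le_rfl]
  ring

lemma res_mul_right {R : Type*} [CommRing R] (f g₁ g₂ : Polynomial R) (m n₁ n₂ : ℕ)
    (h₁ : g₁.natDegree ≤ n₁) (h₂ : g₂.natDegree ≤ n₂) (hm : f.natDegree ≤ m) :
    resultant f (g₁ * g₂) m (n₁ + n₂) = resultant f g₁ m n₁ * resultant f g₂ m n₂ := by
  obtain ⟨a, rfl⟩ := Nat.exists_eq_add_of_le h₁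
  obtain ⟨b, rfl⟩ := Nat.exists_eq_add_of_le h₂
  rw [show g₁.natDegree + a + (g₂.natDegree + b) = g₁.natDegree + g₂.natDegree + (a + b) by ring,
    resultant_add_right_deg _ _ _ _ _ natDegree_mul_le, resultant_mul_right _ _ _ _ hm,
    resultant_add_right_deg _ _ _ _ _ le_rfl, resultant_add_right_deg _ _ _ _ _ le_rfl]
  ring

lemma res_cube_right {R : Type*} [CommRing R] (f g : Polynomial R) (m n : ℕ)
    (h : g.natDegree ≤ n) (hm : f.natDegree ≤ m) :
    resultant f (g ^ 3) m (n + n + n) = resultant f g m n ^ 3 := by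
  rw [show g ^ 3 = g * g * g by ring,
    res_mul_right _ _ _ _ _ _ (natDegree_mul_le.trans (by omega)) h hm,
    res_mul_right _ _ _ _ _ _ h h hm]
  ring

/-- Over a field `K` of characteristic `0`, the rational function
`φ_t(x) = (x − t)/(x³ + 1)` (with `t ≠ −1`) has second iterate
`φ_t² = f_t/g_t`, where `f_t = (u − t·v)·v²` and `g_t = u³ + v³` with
`u = x − t`, `v = x³ + 1` are polynomials of degree `9` whose resultant is
`(t+1)¹²·(t²−t+1)¹²`.  In particular, for every `t ≠ −1` the second iterate is
not a polynomial (i.e. `g_t` does not divide `f_t`). -/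
theorem second_iterate_resultant (K : Type*) [Field K] [CharZero K]
    (t : K) (ht : t ≠ -1)
    (u v f g : Polynomial K)
    (hu : u = X - C t) (hv : v = X ^ 3 + 1)
    (hf : f = (u - C t * v) * v ^ 2) (hg : g = u ^ 3 + v ^ 3) :
    resultantU 9 f g = (t + 1) ^ 12 * (t ^ 2 - t + 1) ^ 12 ∧ ¬ g ∣ f := by
  have du : u.natDegree ≤ 1 := by rw [hu]; compute_degree
  have dv : v.natDegree ≤ 3 := by rw [hv]; compute_degree
  have cv : v.coeff 3 = 1 := by rw [hv]; simp [coeff_one]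
  have ev : v.eval t = t ^ 3 + 1 := by rw [hv]; simp
  have dg : g.natDegree ≤ 9 := by rw [hg, hu, hv]; compute_degree
  constructor
  · rw [resultantU_eq]
    have dw : (u - C t * v).natDegree ≤ 3 := by rw [hu, hv]; compute_degree
    have r1 : resultant v g 3 9 = (-(t ^ 3 + 1)) ^ 3 := by
      rw [hg, show v ^ 3 = v * v ^ 2 by ring, resultant_add_mul_right _ _ _ _ _
        (by rw [hv]; have : ((X ^ 3 + 1 : K[X]) ^ 2).natDegree ≤ 6 := by compute_degree
            omega) dv]
      rw [show (9 : ℕ) = 3 + 6 by norm_num, resultant_add_right_deg _ _ _ _ _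
        (by rw [hu]; compute_degree), cv,
        show (3 : ℕ) = 1 + 1 + 1 by norm_num, res_cube_right _ _ _ _ du dv, hu,
        resultant_X_sub_C_right _ _ _ dv, ev]
      ring
    have r2 : resultant (u - C t * v) v 3 3 = t ^ 3 + 1 := by
      rw [show u - C t * v = u + v * C (-t) by rw [C_neg]; ring,
        resultant_add_mul_left _ _ _ _ _ (by simp) dv]
      have := resultant_add_left_deg u v 1 3 2 du
      rw [show 1 + 2 = 3 by norm_num] at this
      rw [this, cv, hu, resultant_X_sub_C_left _ _ _ dv, ev]
      ring
    have r3 : resultant (u - C t * v) g 3 9 = (t ^ 3 + 1) ^ 6 := by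
      rw [show g = C (t ^ 3 + 1) * v ^ 3 + (u - C t * v) *
          (u ^ 2 + u * (C t * v) + (C t * v) ^ 2) by
            rw [hg, C_add, C_pow, C_1]; ring]
      have dp : (u ^ 2 + u * (C t * v) + (C t * v) ^ 2).natDegree ≤ 6 := by
        rw [hu, hv]; compute_degree
      rw [resultant_add_mul_right _ _ _ _ _ (by omega) dw, resultant_C_mul_right]
      have := res_cube_right (u - C t * v) v 3 3 dv dw
      rw [show 3 + 3 + 3 = 9 by norm_num] at this
      rw [this, r2]
      ring
    have h1 := res_mul_left (u - C t * v) (v * v) g 3 6 9 dw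
      (natDegree_mul_le.trans (by omega)) dg
    have h2 := res_mul_left v v g 3 3 9 dv dv dg
    norm_num only at h1 h2
    rw [hf, sq v, h1, h2, r1, r3]
    ring
  · intro h
    have key : f + C t * g = u * (v ^ 2 + C t * u ^ 2) := by rw [hf, hg]; ring
    have hd : g ∣ u * (v ^ 2 + C t * u ^ 2) := key ▸ dvd_add h (dvd_mul_left _ _)
    have d7 : (u * (v ^ 2 + C t * u ^ 2)).natDegree = 7 := by
      rw [hu, hv]; compute_degree!
    have d9 : g.natDegree = 9 := by
      rw [hg, hu, hv]; compute_degree!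
    have := natDegree_le_of_dvd hd (by intro h0; rw [h0] at d7; simp at d7)
    omega
end

section
/- Let K be a number field and φ ∈ K(x) a rational map of degree d ≥ 2 with φ² not a polynomial over K̄. Then for every n ≥ 4, the set T_n(φ, S) := {b ∈ ℙ¹(K) : φⁿ(b) ∈ O_{K,S}} of points whose n-th iterate is S-integral satisfies: the set of points φ^{n−4}(b) for b ∈ T_n(φ,S) is a set of bounded height (contained in the finite set T₄(φ,S) = {c ∈ ℙ¹(K) : φ⁴(c) ∈ O_{K,S}}), and T₄(φ,S) is finite. -/
section
open MvPolynomial IsDedekindDomain NumberField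

/-- The coefficient of `x^i y^(d-i)` in a binary form `F` of degree `d`. -/
noncomputable def binaryCoeff {R : Type*} [CommRing R] (d : ℕ)
    (F : MvPolynomial (Fin 2) R) (i : ℕ) : R :=
  MvPolynomial.coeff (Finsupp.single 0 i + Finsupp.single 1 (d - i)) F

/-- The Sylvester matrix of two binary forms `F`, `G` of degree `d`. -/
noncomputable def sylvesterMatrix {R : Type*} [CommRing R] (d : ℕ)
    (F G : MvPolynomial (Fin 2) R) : Matrix (Fin (2 * d)) (Fin (2 * d)) R :=
  Matrix.of fun i j =>
    if (i : ℕ) < d then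
      (if (i : ℕ) ≤ (j : ℕ) ∧ (j : ℕ) ≤ (i : ℕ) + d then
        binaryCoeff d F (d - ((j : ℕ) - (i : ℕ))) else 0)
    else
      (if (i : ℕ) - d ≤ (j : ℕ) ∧ (j : ℕ) ≤ (i : ℕ) then
        binaryCoeff d G (d - ((j : ℕ) - ((i : ℕ) - d))) else 0)

/-- The resultant of two binary forms of degree `d`. -/
noncomputable def binaryResultant {R : Type*} [CommRing R] (d : ℕ)
    (F G : MvPolynomial (Fin 2) R) : R :=
  (sylvesterMatrix d F G).det
end


namespace SUnit

section Pade

open PowerSeries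

variable {K : Type*} [Field K]

/-- The power series expansion of `(t + X)^(-q)`. -/
noncomputable def negPow (t : K) (q : ℕ) : PowerSeries K :=
  PowerSeries.mk fun i => (-1) ^ i * (Nat.multichoose q i : K) * (t⁻¹) ^ (q + i)

lemma negPow_zero (t : K) : negPow t 0 = 1 := by
  ext i
  cases i with
  | zero => simp [negPow]
  | succ i => simp [negPow, PowerSeries.coeff_one]

lemma negPow_succ {t : K} (ht : t ≠ 0) (q : ℕ) :
    (C t + X) * negPow t (q + 1) = negPow t q := by
  ext i
  cases i with
  | zero => 
    simp [negPow, add_mul, pow_succ]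
    field_simp
  | succ i =>
    simp only [negPow, add_mul, map_add, PowerSeries.coeff_C_mul, PowerSeries.coeff_succ_X_mul,
      PowerSeries.coeff_mk, Nat.multichoose_succ_succ]
    push_cast
    have : t * t⁻¹ = 1 := mul_inv_cancel₀ ht
    have e : t * t⁻¹ ^ (q + 1 + (i + 1)) = t⁻¹ ^ (q + 1 + i) := by
      rw [← add_assoc, pow_succ, mul_comm, mul_assoc, mul_comm _ t, this, mul_one]
    rw [show q + (i + 1) = q + 1 + i by ring, pow_succ (-1 : K) i]
    linear_combination ((-1) ^ i * (-1) * ((q.multichoose (i+1) : K) + ((q+1).multichoose i : K))) * e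

lemma multichoose_deriv (q i : ℕ) :
    (i + 1) * Nat.multichoose q (i + 1) = q * Nat.multichoose (q + 1) i := by
  rw [Nat.multichoose_eq, Nat.multichoose_eq]
  cases q with
  | zero => simp
  | succ q =>
    have e1 : q + 1 + (i + 1) - 1 = q + 1 + i := by omega
    have e2 : q + 1 + 1 + i - 1 = q + 1 + i := by omega
    rw [e1, e2]
    have h3 := Nat.choose_succ_right_eq (q + 1 + i) i
    rw [show q + 1 + i - i = q + 1 by omega] at h3
    linarith

lemma negPow_deriv (t : K) (q : ℕ) :
    PowerSeries.derivative K (negPow t q) = - (q : K) • negPow t (q + 1) := by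
  ext i
  rw [PowerSeries.coeff_derivative]
  simp only [negPow, PowerSeries.coeff_mk, PowerSeries.coeff_smul, smul_eq_mul]
  have := congrArg (Nat.cast : ℕ → K) (multichoose_deriv q i)
  push_cast at this
  rw [show q + (i + 1) = q + 1 + i by ring, pow_succ (-1 : K) i]
  linear_combination ((-1) ^ i * (-1) * t⁻¹ ^ (q + 1 + i)) * this

/-- Residue at `a` of `(s-a)^(-p) (s-b)^(-q) (s-c)^(-r)`. -/
noncomputable def rho (a b c : K) (p q r : ℕ) : K :=
  coeff p (X * (negPow (a - b) q * negPow (a - c) r))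

lemma rho_swap (a b c : K) (p q r : ℕ) : rho a b c p q r = rho a c b p r q := by
  unfold rho; rw [mul_comm (negPow _ _)]

lemma rho_first {a b c : K} (hab : a ≠ b) (p q r : ℕ) :
    rho a b c (p + 1) q r - rho a b c p (q + 1) r = (a - b) * rho a b c (p + 1) (q + 1) r := by
  unfold rho
  rw [← negPow_succ (sub_ne_zero.2 hab) q, ← PowerSeries.coeff_C_mul,
    ← PowerSeries.coeff_succ_X_mul p, ← map_sub]
  congr 1
  ring

lemma rho_third {a b c : K} (hca : c ≠ a) (hcb : c ≠ b) (p q r : ℕ) :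
    rho c a b r (p + 1) q - rho c a b r p (q + 1) = (a - b) * rho c a b r (p + 1) (q + 1) := by
  unfold rho
  rw [← negPow_succ (sub_ne_zero.2 hcb) q, ← negPow_succ (sub_ne_zero.2 hca) p,
    ← PowerSeries.coeff_C_mul, ← map_sub]
  congr 1
  simp only [map_sub]
  ring

lemma rho_deriv (a b c : K) (p q r : ℕ) :
    (p : K) * rho a b c (p + 1) q r + q * rho a b c p (q + 1) r + r * rho a b c p q (r + 1) = 0 := by
  have h : PowerSeries.derivative K (negPow (a - b) q * negPow (a - c) r)
      = - (q : K) • (negPow (a - b) (q + 1) * negPow (a - c) r)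
        - (r : K) • (negPow (a - b) q * negPow (a - c) (r + 1)) := by
    rw [Derivation.leibniz, negPow_deriv, negPow_deriv]
    simp only [smul_eq_mul, PowerSeries.smul_eq_C_mul]
    simp only [map_neg]
    ring
  have h2 := congrArg (fun s => coeff p (X * s)) h
  have h3 : coeff p (X * PowerSeries.derivative K (negPow (a - b) q * negPow (a - c) r))
      = p * coeff p (negPow (a - b) q * negPow (a - c) r) := by
    cases p with
    | zero => simp
    | succ p =>
      rw [PowerSeries.coeff_succ_X_mul, PowerSeries.coeff_derivative]
      push_cast; ring
  beta_reduce at h2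
  rw [h3] at h2
  unfold rho
  rw [PowerSeries.coeff_succ_X_mul, h2]
  simp only [mul_sub, mul_smul_comm, map_sub, PowerSeries.coeff_smul, smul_eq_mul]
  ring

/-- Vector of residues. -/
noncomputable def resVec (a b c : K) (p q r : ℕ) : Fin 3 → K :=
  ![rho a b c p q r, rho b a c q p r, rho c a b r p q]

/-- abstract contiguity -/
structure Contig {V : Type*} [AddCommGroup V] [Module K V] (a b c : K) (f : ℕ → ℕ → ℕ → V) : Prop where
  ab : ∀ p q r, f (p + 1) q r - f p (q + 1) r = (a - b) • f (p + 1) (q + 1) r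
  ac : ∀ p q r, f (p + 1) q r - f p q (r + 1) = (a - c) • f (p + 1) q (r + 1)
  bc : ∀ p q r, f p (q + 1) r - f p q (r + 1) = (b - c) • f p (q + 1) (r + 1)
  der : ∀ p q r : ℕ, (p : K) • f (p + 1) q r + (q : K) • f p (q + 1) r + (r : K) • f p q (r + 1) = 0

lemma contig_resVec {a b c : K} (hab : a ≠ b) (hac : a ≠ c) (hbc : b ≠ c) :
    Contig a b c (resVec a b c) where
  ab p q r := by
    have h1 := rho_first (c := c) hab p q r
    have h2 := rho_first (c := c) hab.symm q p r
    have h3 := rho_third hac.symm hbc.symm p q r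
    ext i; fin_cases i <;> simp [resVec]
    · linear_combination h1
    · linear_combination -h2
    · linear_combination h3
  ac p q r := by
    have h1 := rho_first (c := b) hac p r q
    have h2 := rho_third hab.symm hbc p r q
    have h3 := rho_first (c := b) hac.symm r p q
    simp only [rho_swap a c b] at h1
    ext i; fin_cases i <;> simp [resVec]
    · linear_combination h1
    · linear_combination h2
    · linear_combination -h3
  bc p q r := by
    have h1 := rho_third hab hac q r p
    have h2 := rho_first (c := a) hbc q r p
    have h3 := rho_first (c := a) hbc.symm r q p
    simp only [rho_swap b c a, rho_swap c b a] at h2 h3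
    ext i; fin_cases i <;> simp [resVec]
    · linear_combination h1
    · linear_combination h2
    · linear_combination -h3
  der p q r := by
    have h1 := rho_deriv a b c p q r
    have h2 := rho_deriv b a c q p r
    have h3 := rho_deriv c a b r p q
    ext i; fin_cases i <;> simp [resVec]
    · linear_combination h1
    · linear_combination h2
    · linear_combination h3

namespace Contig
variable {V : Type*} [AddCommGroup V] [Module K V] {a b c : K} {f : ℕ → ℕ → ℕ → V}

lemma swap12 (h : Contig a b c f) : Contig b a c (fun p q r => f q p r) where
  ab p q r := by have := h.ab q p r; rw [← neg_sub a b, neg_smul, ← this]; abel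
  ac p q r := h.bc q p r
  bc p q r := h.ac q p r
  der p q r := by rw [← h.der q p r]; abel

lemma swap13 (h : Contig a b c f) : Contig c b a (fun p q r => f r q p) where
  ab p q r := by have := h.bc r q p; rw [← neg_sub b c, neg_smul, ← this]; abel
  ac p q r := by have := h.ac r q p; rw [← neg_sub a c, neg_smul, ← this]; abel
  bc p q r := by have := h.ab r q p; rw [← neg_sub a b, neg_smul, ← this]; abel
  der p q r := by rw [← h.der r q p]; abel

/-- descent in the first index -/
lemma descent [CharZero K] (h : Contig a b c f) (W : Submodule K V) (p q r : ℕ)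
    (h1 : f (p + 2) (q + 1) (r + 1) ∈ W) (h2 : f (p + 1) (q + 1) (r + 1) ∈ W) :
    f p (q + 1) (r + 1) ∈ W := by
  have e1 := h.ab p q (r + 1)
  have e2 := h.ac p (q + 1) r
  have e3 := h.ab (p + 1) q r
  have e4 := h.ac (p + 1) (q + 1) r
  have d := h.der (p + 1) q r
  have key : ((p + q + r + 1 : ℕ) : K) • f p (q + 1) (r + 1) =
      - (((p + 1 : ℕ) : K) * ((a - b) + (a - c)) + q * (a - c) + r * (a - b)) • f (p + 1) (q + 1) (r + 1)
      - (((p + 1 : ℕ) : K) * ((a - b) * (a - c))) • f (p + 2) (q + 1) (r + 1) := by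
    have g1 : f (p + 1) q (r + 1) = f p (q + 1) (r + 1) + (a - b) • f (p + 1) (q + 1) (r + 1) := by
      rw [← e1]; abel
    have g2 : f (p + 1) (q + 1) r = f p (q + 1) (r + 1) + (a - c) • f (p + 1) (q + 1) (r + 1) := by
      rw [← e2]; abel
    have g4 : f (p + 1 + 1) (q + 1) r = f (p + 1) (q + 1) (r + 1) + (a - c) • f (p + 2) (q + 1) (r + 1) := by
      rw [← e4]; abel
    have g3 : f (p + 1 + 1) q r = f (p + 1) (q + 1) r + (a - b) • f (p + 1 + 1) (q + 1) r := by
      rw [← e3]; abel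
    rw [g4] at g3
    rw [g3, g1, g2] at d
    rw [← sub_eq_zero, ← d]
    push_cast
    module
  have hne : ((p + q + r + 1 : ℕ) : K) ≠ 0 := Nat.cast_ne_zero.2 (Nat.succ_ne_zero _)
  rw [← W.smul_mem_iff hne, key]
  exact W.sub_mem (W.smul_mem _ h2) (W.smul_mem _ h1)

/-- if the two vectors lie in `W` then so do the base ones. -/
lemma base_mem [CharZero K] (h : Contig a b c f) (W : Submodule K V) (p q r : ℕ)
    (h0 : f (p + 1) (q + 1) (r + 1) ∈ W) (h1 : f p (q + 1) (r + 1) ∈ W) :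
    f 0 1 1 ∈ W ∧ f 1 0 1 ∈ W := by
  have step : ∀ {a b c : K} {f : ℕ → ℕ → ℕ → V}, Contig a b c f → ∀ q r p, 
      f (p + 1) (q + 1) (r + 1) ∈ W → f p (q + 1) (r + 1) ∈ W →
      f 1 (q + 1) (r + 1) ∈ W ∧ f 0 (q + 1) (r + 1) ∈ W := by
    intro a b c f h q r p
    induction p with
    | zero => exact fun h1 h2 => ⟨h1, h2⟩
    | succ p ih => exact fun h1 h2 => ih h2 (h.descent W p q r h1 h2)
  obtain ⟨h0, h1⟩ := step h q r p h0 h1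
  have h2 : f 1 q (r + 1) ∈ W := by
    have := h.ab 0 q (r + 1)
    rw [sub_eq_iff_eq_add] at this
    simp only [zero_add] at this
    rw [this]; exact W.add_mem (W.smul_mem _ h0) h1
  obtain ⟨h0, h2⟩ := step h.swap12 0 r q h0 h2
  simp only [zero_add] at h0 h2
  have h3 : f 1 1 r ∈ W := by
    have := h.bc 1 0 r
    rw [sub_eq_iff_eq_add] at this
    simp only [zero_add] at this
    rw [this]; exact W.add_mem (W.smul_mem _ h0) h2
  obtain ⟨h0, h3⟩ := step h.swap13 0 0 r h0 h3
  simp only [zero_add] at h0 h3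
  have e1 := h.ac 0 1 0
  have e2 := h.bc 1 0 0
  simp only [zero_add] at e1 e2
  constructor
  · rw [show f 0 1 1 = f 1 1 0 - (a - c) • f 1 1 1 by rw [← e1]; abel]
    exact W.sub_mem h3 (W.smul_mem _ h0)
  · rw [show f 1 0 1 = f 1 1 0 - (b - c) • f 1 1 1 by rw [← e2]; abel]
    exact W.sub_mem h3 (W.smul_mem _ h0)

end Contig

lemma rho_zero (a b c : K) (q r : ℕ) : rho a b c 0 q r = 0 := by simp [rho]

lemma sum_resVec {a b c : K} (hab : a ≠ b) (hac : a ≠ c) (hbc : b ≠ c) (n p q r : ℕ)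
    (hn : p + q + r = n + 1) :
    ∑ i, resVec a b c p q r i = if n = 0 then 1 else 0 := by
  have h := contig_resVec hab hac hbc
  have hs : ∀ u w : Fin 3 → K, ∑ i, (u - w) i = ∑ i, u i - ∑ i, w i := by
    intro u w; simp [Finset.sum_sub_distrib]
  have hm : ∀ (s : K) (u : Fin 3 → K), ∑ i, (s • u) i = s * ∑ i, u i := by
    intro s u; simp [Finset.mul_sum]
  induction n generalizing p q r with
  | zero =>
    have : (p = 1 ∧ q = 0 ∧ r = 0) ∨ (p = 0 ∧ q = 1 ∧ r = 0) ∨ (p = 0 ∧ q = 0 ∧ r = 1) := by omega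
    rcases this with ⟨rfl, rfl, rfl⟩ | ⟨rfl, rfl, rfl⟩ | ⟨rfl, rfl, rfl⟩ <;>
      simp [Fin.sum_univ_three, resVec, rho, negPow_zero]
  | succ n ih =>
    have two : ∀ p, 2 ≤ p → PowerSeries.coeff p (X : PowerSeries K) = 0 := by
      intro p hp; rw [PowerSeries.coeff_X, if_neg (by omega)]
    have fin : ∀ (u v w : Fin 3 → K) (s : K), s ≠ 0 → u - v = s • w →
        (∑ i, u i = if n = 0 then 1 else 0) → (∑ i, v i = if n = 0 then 1 else 0) →
        ∑ i, w i = 0 := by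
      intro u v w s hs0 e h1 h2
      have := congrArg (fun u : Fin 3 → K => ∑ i, u i) e
      beta_reduce at this
      rw [hs, hm, h1, h2, sub_self] at this
      exact (mul_eq_zero.1 this.symm).resolve_left hs0
    rw [if_neg (Nat.succ_ne_zero n)]
    rcases p with _ | p
    · rcases q with _ | q
      · have : 2 ≤ r := by omega
        simp [Fin.sum_univ_three, resVec, rho, negPow_zero, two r this]
      · rcases r with _ | r
        · have : 2 ≤ q + 1 := by omega
          simp [Fin.sum_univ_three, resVec, rho, negPow_zero, two _ this]
        · exact fin _ _ _ _ (sub_ne_zero.2 hbc) (h.bc 0 q r) (ih _ _ _ (by omega)) (ih _ _ _ (by omega))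
    · rcases q with _ | q
      · rcases r with _ | r
        · have : 2 ≤ p + 1 := by omega
          simp [Fin.sum_univ_three, resVec, rho, negPow_zero, two _ this]
        · exact fin _ _ _ _ (sub_ne_zero.2 hac) (h.ac p 0 r) (ih _ _ _ (by omega)) (ih _ _ _ (by omega))
      · exact fin _ _ _ _ (sub_ne_zero.2 hab) (h.ab p q r) (ih _ _ _ (by omega)) (ih _ _ _ (by omega))

lemma rho_one (a b c : K) (q r : ℕ) : rho a b c 1 q r = (a - b)⁻¹ ^ q * (a - c)⁻¹ ^ r := by
  unfold rho
  rw [← zero_add 1, PowerSeries.coeff_succ_X_mul]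
  simp [negPow]

lemma resVec_011 {a b c : K} : resVec a b c 0 1 1 = (b - c)⁻¹ • ![0, 1, -1] := by
  have : (c - b)⁻¹ = -(b - c)⁻¹ := by rw [← neg_sub b c, inv_neg]
  ext i; fin_cases i <;> simp [resVec, rho_one, rho_zero, this]

lemma resVec_101 {a b c : K} : resVec a b c 1 0 1 = (a - c)⁻¹ • ![1, 0, -1] := by
  have : (c - a)⁻¹ = -(a - c)⁻¹ := by rw [← neg_sub a c, inv_neg]
  ext i; fin_cases i <;> simp [resVec, rho_one, rho_zero, this]

end Pade
end SUnit

namespace SUnit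
section Aux
open PowerSeries
variable {K : Type*} [Field K]

lemma multichoose_le (q i : ℕ) : Nat.multichoose q i ≤ 2 ^ (q + i) := by
  rw [Nat.multichoose_eq]
  exact (Nat.choose_le_two_pow _ _).trans (Nat.pow_le_pow_right (by norm_num) (by omega))

lemma abv_natCast_le (v : AbsoluteValue K ℝ) (n : ℕ) : v (n : K) ≤ n := by
  induction n with
  | zero => simp
  | succ n ih =>
    push_cast
    exact (v.add_le _ _).trans (by simpa using ih)

lemma abv_natCast_le_one {v : AbsoluteValue K ℝ} (hv : IsNonarchimedean v) (n : ℕ) :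
    v (n : K) ≤ 1 := by
  induction n with
  | zero => simp
  | succ n ih =>
    push_cast
    exact (hv _ _).trans (by simpa using ih)

lemma abv_sum_le_of {α : Type*} {v : AbsoluteValue K ℝ} (hv : IsNonarchimedean v) (s : Finset α)
    (f : α → K) (B : ℝ) (hB : 0 ≤ B) (h : ∀ i ∈ s, v (f i) ≤ B) : v (∑ i ∈ s, f i) ≤ B := by
  classical
  induction s using Finset.induction_on with
  | empty => simpa
  | insert a s ha ih =>
    rw [Finset.sum_insert ha]
    exact (hv _ _).trans (max_le (h _ (by simp)) (ih fun i hi => h i (by simp [hi])))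

lemma term_bound (v : AbsoluteValue K ℝ) {t s : K} (ht : t ≠ 0) (hs : s ≠ 0) (i j q r k : ℕ)
    (hq : q + i ≤ k) (hr : r + j ≤ k) (m : ℝ) (htm : v t ≤ m) (hsm : v s ≤ m) :
    v (t ^ k * s ^ k * (((-1) ^ i * (Nat.multichoose q i : K) * (t⁻¹) ^ (q + i)) *
      ((-1) ^ j * (Nat.multichoose r j : K) * (s⁻¹) ^ (r + j)))) ≤
    v (Nat.multichoose q i : K) * v (Nat.multichoose r j : K) * m ^ (2 * k - q - r - (i + j)) := by
  have h1 : t ^ k * (t⁻¹) ^ (q + i) = t ^ (k - (q + i)) := by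
    rw [inv_pow, pow_sub₀ _ ht hq]
  have h2 : s ^ k * (s⁻¹) ^ (r + j) = s ^ (k - (r + j)) := by
    rw [inv_pow, pow_sub₀ _ hs hr]
  have e : t ^ k * s ^ k * (((-1) ^ i * (Nat.multichoose q i : K) * (t⁻¹) ^ (q + i)) *
      ((-1) ^ j * (Nat.multichoose r j : K) * (s⁻¹) ^ (r + j))) =
      (-1) ^ i * (-1) ^ j * (Nat.multichoose q i : K) * (Nat.multichoose r j : K) *
        (t ^ (k - (q + i)) * s ^ (k - (r + j))) := by
    rw [← h1, ← h2]; ring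
  rw [e]
  simp only [map_mul, map_pow, map_neg_eq_map, map_one, one_pow, one_mul]
  have hm : 0 ≤ m := (v.nonneg t).trans htm
  have : m ^ (2 * k - q - r - (i + j)) = m ^ (k - (q + i)) * m ^ (k - (r + j)) := by
    rw [← pow_add]; congr 1; omega
  rw [this]
  gcongr

lemma coeff_bound (v : AbsoluteValue K ℝ) {t s : K} (ht : t ≠ 0) (hs : s ≠ 0) (n q r k : ℕ)
    (hq : q + n ≤ k) (hr : r + n ≤ k) (m : ℝ) (htm : v t ≤ m) (hsm : v s ≤ m) :
    v (t ^ k * s ^ k * coeff n (negPow t q * negPow s r)) ≤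
      (n + 1) * (2 ^ k * 2 ^ k) * m ^ (2 * k - q - r - n) ∧
    (IsNonarchimedean v → v (t ^ k * s ^ k * coeff n (negPow t q * negPow s r)) ≤
      m ^ (2 * k - q - r - n)) := by
  have hm : 0 ≤ m := (v.nonneg t).trans htm
  rw [PowerSeries.coeff_mul, Finset.mul_sum]
  simp only [negPow, PowerSeries.coeff_mk]
  have hterm : ∀ x ∈ Finset.HasAntidiagonal.antidiagonal n, 
     v (t ^ k * s ^ k * (((-1) ^ x.1 * (Nat.multichoose q x.1 : K) * (t⁻¹) ^ (q + x.1)) *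
      ((-1) ^ x.2 * (Nat.multichoose r x.2 : K) * (s⁻¹) ^ (r + x.2)))) ≤
    v (Nat.multichoose q x.1 : K) * v (Nat.multichoose r x.2 : K) * m ^ (2 * k - q - r - n) := by
    intro x hx
    rw [Finset.HasAntidiagonal.mem_antidiagonal] at hx
    have := term_bound v ht hs x.1 x.2 q r k (by omega) (by omega) m htm hsm
    rwa [hx] at this
  constructor
  · refine (v.sum_le _ _).trans ?_
    have : ∀ x ∈ Finset.HasAntidiagonal.antidiagonal n, 
     v (t ^ k * s ^ k * (((-1) ^ x.1 * (Nat.multichoose q x.1 : K) * (t⁻¹) ^ (q + x.1)) *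
      ((-1) ^ x.2 * (Nat.multichoose r x.2 : K) * (s⁻¹) ^ (r + x.2)))) ≤
      (2 ^ k * 2 ^ k) * m ^ (2 * k - q - r - n) := by
      intro x hx
      refine (hterm x hx).trans ?_
      rw [Finset.HasAntidiagonal.mem_antidiagonal] at hx
      have b : ∀ q i : ℕ, q + i ≤ k → v (Nat.multichoose q i : K) ≤ 2 ^ k := by
        intro q i hi
        refine (abv_natCast_le v _).trans ?_
        have := (multichoose_le q i).trans (Nat.pow_le_pow_right (n := 2) (by norm_num) hi)
        exact_mod_cast this
      gcongr
      · exact b _ _ (by omega)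
      · exact b _ _ (by omega)
    refine (Finset.sum_le_card_nsmul _ _ _ this).trans ?_
    simp only [Finset.Nat.card_antidiagonal, nsmul_eq_mul]
    push_cast
    exact le_of_eq (by ring)
  · intro hv
    refine abv_sum_le_of hv _ _ _ (by positivity) fun x hx => (hterm x hx).trans ?_
    have h1 := abv_natCast_le_one hv (Nat.multichoose q x.1)
    have h2 := abv_natCast_le_one hv (Nat.multichoose r x.2)
    have h3 : 0 ≤ m ^ (2 * k - q - r - n) := by positivity
    have h4 := mul_le_one₀ h1 (v.nonneg _) h2
    exact mul_le_of_le_one_left h3 h4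

/-- bound for `rho` -/
lemma rho_bound (v : AbsoluteValue K ℝ) {a b c : K} (hab : a ≠ b) (hac : a ≠ c) (p q r N : ℕ)
    (hp : p ≤ N + 1) (hq : q ≤ N + 1) (hr : r ≤ N + 1) (hpq : p + q ≤ 2 * N + 2)
    (hpqr : 3 * N + 2 ≤ p + q + r)
    (m : ℝ) (hm : 1 ≤ m) (htm : v (a - b) ≤ m) (hsm : v (a - c) ≤ m) :
    v ((a - b) ^ (2 * N + 1) * (a - c) ^ (2 * N + 1) * rho a b c p q r) ≤ 64 ^ (N + 1) * m ^ (N + 1) ∧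
    (IsNonarchimedean v → 
      v ((a - b) ^ (2 * N + 1) * (a - c) ^ (2 * N + 1) * rho a b c p q r) ≤ m ^ (N + 1)) := by
  have hm0 : 0 ≤ m := by linarith
  rcases p with _ | n
  · simp only [rho_zero, mul_zero, map_zero]
    exact ⟨by positivity, fun _ => by positivity⟩
  · unfold rho
    rw [PowerSeries.coeff_succ_X_mul]
    obtain ⟨h1, h2⟩ := coeff_bound v (sub_ne_zero.2 hab) (sub_ne_zero.2 hac) n q r (2 * N + 1)
      (by omega) (by omega) m htm hsm
    have h3 : m ^ (2 * (2 * N + 1) - q - r - n) ≤ m ^ (N + 1) := pow_le_pow_right₀ hm (by omega)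
    refine ⟨h1.trans ?_, fun hv => (h2 hv).trans h3⟩
    gcongr
    have : n + 1 ≤ 2 ^ (N + 1) := (by omega : n + 1 ≤ N + 1).trans (Nat.lt_two_pow_self).le
    have h5 : ((n : ℝ) + 1) ≤ 2 ^ (N + 1) := by exact_mod_cast this
    calc ((n : ℝ) + 1) * (2 ^ (2 * N + 1) * 2 ^ (2 * N + 1)) 
        ≤ 2 ^ (N + 1) * (2 ^ (2 * N + 1) * 2 ^ (2 * N + 1)) := by gcongr
      _ = 2 ^ (5 * N + 3) := by rw [← pow_add, ← pow_add]; congr 1; omega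
      _ ≤ 2 ^ (6 * (N + 1)) := pow_le_pow_right₀ (by norm_num) (by omega)
      _ = 64 ^ (N + 1) := by rw [pow_mul]; norm_num

lemma exists_aux_vector [CharZero K] (X u : Fin 3 → K) (hX : ∀ i, X i ≠ 0)
    (hsum : X 0 + X 1 + X 2 = 0) (hu : u ≠ 0) (N : ℕ) :
    ∃ g : Fin 3 → K, X 0 ^ (2 * N + 1) * g 0 + X 1 ^ (2 * N + 1) * g 1 + X 2 ^ (2 * N + 1) * g 2 = 0 ∧
      (∃ i j, u i * g j ≠ u j * g i) ∧
      ∀ (v : AbsoluteValue K ℝ) (m : ℝ), 1 ≤ m → (∀ i, v (X i) ≤ m) → ∀ i,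
        v (g i) ≤ 64 ^ (N + 1) * m ^ (N + 1) ∧ (IsNonarchimedean v → v (g i) ≤ m ^ (N + 1)) := by
  set k := 2 * N + 1 with hk
  set x := X 0
  set y := X 1
  set z := X 2
  have hx : x ≠ 0 := hX 0
  have hy : y ≠ 0 := hX 1
  have hz : z ≠ 0 := hX 2
  have hzz : z = -y - x := by linear_combination hsum
  have hab : -y ≠ x := fun h => hz (by rw [hzz, h]; ring)
  have hac : -y ≠ 0 := neg_ne_zero.2 hy
  have hbc : x ≠ 0 := hx
  -- the candidate
  let G : ℕ → Fin 3 → K := fun p => 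
    ![y ^ k * z ^ k, x ^ k * z ^ k, x ^ k * y ^ k] * resVec (-y) x 0 p (N + 1) (N + 1)
  have hC := contig_resVec hab hac hbc
  have hG : ∀ p, N ≤ p → p ≤ N + 1 → 
      (x ^ k * G p 0 + y ^ k * G p 1 + z ^ k * G p 2 = 0 ∧ ∀ (v : AbsoluteValue K ℝ) (m : ℝ), 
        1 ≤ m → (∀ i, v (X i) ≤ m) → ∀ i,
        v (G p i) ≤ 64 ^ (N + 1) * m ^ (N + 1) ∧ (IsNonarchimedean v → v (G p i) ≤ m ^ (N + 1))) := by
    intro p hp hp1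
    constructor
    · have := sum_resVec hab hac hbc (p + 2 * N + 1) p (N + 1) (N + 1) (by omega)
      rw [if_neg (by omega), Fin.sum_univ_three] at this
      simp only [G, Pi.mul_apply, Matrix.cons_val]
      linear_combination (x ^ k * y ^ k * z ^ k) * this
    · intro v m hm hv i
      have v0 : v x ≤ m := hv 0
      have v1 : v y ≤ m := hv 1
      have v2 : v z ≤ m := hv 2
      fin_cases i
      · have := rho_bound v hab hac p (N + 1) (N + 1) N hp1 le_rfl le_rfl (by omega) (by omega) m hm
          (by rwa [← hzz]) (by simpa using v1)
        rw [map_mul, map_mul, map_pow, map_pow, sub_zero, map_neg_eq_map, ← hzz] at this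
        convert! this using 3 <;>
        · simp only [G, resVec, Pi.mul_apply, map_mul, map_pow, Matrix.cons_val, ← hzz, sub_zero,
            map_neg_eq_map, Fin.zero_eta, Fin.isValue]
          ring
      · have := rho_bound v hab.symm hbc (N + 1) p (N + 1) N le_rfl hp1 le_rfl (by omega) (by omega) m hm
          (by rw [v.map_sub, ← hzz]; exact v2) (by simpa using v0)
        rw [map_mul, map_mul, map_pow, v.map_sub x] at this
        convert! this using 3 <;>
        · simp only [G, resVec, Pi.mul_apply, map_mul, map_pow, Matrix.cons_val, ← hzz, sub_zero,
            Fin.mk_one, Fin.isValue]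
          ring
      · have := rho_bound v hac.symm hbc.symm (N + 1) p (N + 1) N le_rfl hp1 le_rfl (by omega) (by omega) m hm
          (by simpa using v1) (by simpa using v0)
        rw [map_mul, map_mul, map_pow, map_pow, zero_sub, zero_sub, neg_neg, map_neg_eq_map] at this
        convert! this using 3 <;>
        · simp only [G, resVec, Pi.mul_apply, map_mul, map_pow, Matrix.cons_val, zero_sub,
            map_neg_eq_map, Fin.reduceFinMk, Fin.isValue]
          ring
  by_contra hcon
  push Not at hcon
  have hGu : ∀ p, N ≤ p → p ≤ N + 1 → ∀ i j, u i * G p j = u j * G p i := by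
    intro p hp hp1
    by_contra hne
    push Not at hne
    obtain ⟨v, m, hm, hv, i, hi⟩ := hcon (G p) (hG p hp hp1).1 hne
    have := (hG p hp hp1).2 v m hm hv i
    exact absurd (this.2 (hi this.1).1) (not_le.2 (hi this.1).2)
  let ut : Fin 3 → K := fun i => u i * X i ^ k
  let W : Submodule K (Fin 3 → K) :=
    { carrier := {w | ∀ i j, ut i * w j = ut j * w i}
      add_mem' := by
        intro a b ha hb i j
        simp only [Pi.add_apply, mul_add, ha i j, hb i j]
      zero_mem' := by intro i j; simp
      smul_mem' := by
        intro c a ha i j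
        simp only [Pi.smul_apply, smul_eq_mul]
        linear_combination c * ha i j }
  have hGX : ∀ p i, X i ^ k * G p i = x ^ k * y ^ k * z ^ k * resVec (-y) x 0 p (N + 1) (N + 1) i := by
    intro p i
    fin_cases i <;> simp [G, x, y, z] <;> ring
  have hmem : ∀ p, N ≤ p → p ≤ N + 1 → resVec (-y) x 0 p (N + 1) (N + 1) ∈ W := by
    intro p hp hp1 i j
    have h := hGu p hp hp1 i j
    have hi := hGX p i
    have hj := hGX p j
    have h0 : x ^ k * y ^ k * z ^ k ≠ 0 := by positivity
    apply mul_left_cancel₀ h0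
    simp only [ut]
    linear_combination (X i ^ k * X j ^ k) * h - u i * X i ^ k * hj + u j * X j ^ k * hi
  obtain ⟨m1, m2⟩ := hC.base_mem W N N N (hmem (N + 1) (by omega) le_rfl) (hmem N le_rfl (by omega))
  rw [resVec_011, W.smul_mem_iff (inv_ne_zero (sub_ne_zero.2 hbc))] at m1
  rw [resVec_101, W.smul_mem_iff (inv_ne_zero (sub_ne_zero.2 hac))] at m2
  have e1 := m1 0 1
  have e2 := m2 1 0
  have e3 := m1 1 2
  simp at e1 e2 e3
  have e4 : ut 2 = 0 := by rw [← e3, e2]; simp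
  apply hu
  funext i
  have : ut i = 0 := by fin_cases i <;> assumption
  simpa [ut, hX i] using this
end Aux
end SUnit

namespace SUnit
section Hgt
open Height Height.AdmissibleAbsValues Function
variable {K : Type*} [Field K] [AdmissibleAbsValues K]

lemma le_sup3 (f : Fin 3 → ℝ) (i : Fin 3) : f i ≤ ⨆ j, f j :=
  le_ciSup (Set.finite_range f).bddAbove i

lemma finsupp3 {x : Fin 3 → K} (hx : ∀ i, x i ≠ 0) :
    (fun v : nonarchAbsVal (K := K) ↦ ⨆ i, v.val (x i)).HasFiniteMulSupport :=
  HasFiniteMulSupport.iSup fun i => hasFiniteMulSupport (hx i)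

lemma height_ineq [CharZero K] (X u : Fin 3 → K) (hX : ∀ i, X i ≠ 0) (hu : ∀ i, u i ≠ 0)
    (hsum : X 0 + X 1 + X 2 = 0) (hX2 : X 2 = -1) (N : ℕ)
    (husum : X 0 ^ (2 * N + 1) * u 0 + X 1 ^ (2 * N + 1) * u 1 + X 2 ^ (2 * N + 1) * u 2 = 0) :
    mulHeight X ^ (2 * N + 1) ≤
      (2 * 64 ^ (N + 1)) ^ totalWeight K * mulHeight u * mulHeight X ^ (N + 1) := by
  have hu0 : u ≠ 0 := fun h => hu 0 (by simp [h])
  have hX0 : X ≠ 0 := fun h => hX 0 (by simp [h])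
  obtain ⟨g, hg, ⟨i0, j0, hij⟩, hb⟩ := exists_aux_vector X u hX hsum hu0 N
  set k := 2 * N + 1 with hk
  let w : Fin 3 → K := ![u 1 * g 2 - u 2 * g 1, u 2 * g 0 - u 0 * g 2, u 0 * g 1 - u 1 * g 0]
  have hwP : ∀ i, w i * X 0 ^ k = w 0 * X i ^ k := by
    intro i
    fin_cases i
    · rfl
    · simp only [w, Fin.mk_one, Matrix.cons_val]
      linear_combination u 2 * hg - g 2 * husum
    · simp only [w, Fin.reduceFinMk, Matrix.cons_val]
      linear_combination g 1 * husum - u 1 * hg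
  have hP0 : X 0 ^ k ≠ 0 := pow_ne_zero _ (hX 0)
  have hwc : w = (w 0 / X 0 ^ k) • (X ^ k) := by
    funext i
    simp only [Pi.smul_apply, Pi.pow_apply, smul_eq_mul]
    rw [div_mul_eq_mul_div, ← hwP i, mul_div_cancel_right₀ _ hP0]
  have hw0 : w ≠ 0 := by
    intro h
    have h0 := congrFun h 0
    have h1 := congrFun h 1
    have h2 := congrFun h 2
    simp only [w, Matrix.cons_val, Pi.zero_apply] at h0 h1 h2
    apply hij
    fin_cases i0 <;> fin_cases j0 <;> simp <;> grind
  have hc : w 0 / X 0 ^ k ≠ 0 := by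
    intro h; apply hw0; rw [hwc, h, zero_smul]
  have hwi : ∀ i, w i ≠ 0 := by
    intro i; rw [hwc]; simp only [Pi.smul_apply, Pi.pow_apply, smul_eq_mul]
    exact mul_ne_zero hc (pow_ne_zero _ (hX i))
  rw [← mulHeight_pow, ← mulHeight_smul_eq_mulHeight _ hc, ← hwc]
  rw [mulHeight_eq hw0, mulHeight_eq hu0, mulHeight_eq hX0]
  have hm1 : ∀ v : AbsoluteValue K ℝ, 1 ≤ ⨆ i, v (X i) := by
    intro v
    have := le_sup3 (fun i => v (X i)) 2
    simpa [hX2] using this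
  have hun : ∀ v : AbsoluteValue K ℝ, 0 ≤ ⨆ i, v (u i) := fun v => Real.iSup_nonneg fun i => v.nonneg _
  have hxn : ∀ v : AbsoluteValue K ℝ, 0 ≤ ⨆ i, v (X i) := fun v => Real.iSup_nonneg fun i => v.nonneg _
  have hwn : ∀ v : AbsoluteValue K ℝ, 0 ≤ ⨆ i, v (w i) := fun v => Real.iSup_nonneg fun i => v.nonneg _
  have hle : ∀ (v : AbsoluteValue K ℝ) i, v (u i) ≤ ⨆ i, v (u i) := fun v i => le_sup3 (fun i => v (u i)) i
  have arch : ∀ v : AbsoluteValue K ℝ, ⨆ i, v (w i) ≤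
      2 * 64 ^ (N + 1) * (⨆ i, v (u i)) * (⨆ i, v (X i)) ^ (N + 1) := by
    intro v
    have h := fun i => (hb v _ (hm1 v) (le_sup3 (fun i => v (X i))) i).1
    have key : ∀ i j k l, v (u i * g j - u k * g l) ≤ 
        2 * 64 ^ (N + 1) * (⨆ i, v (u i)) * (⨆ i, v (X i)) ^ (N + 1) := by
      intro i j k l
      refine (v.sub_le_add _ _).trans ?_
      rw [map_mul, map_mul]
      have h1 := mul_le_mul (hle v i) (h j) (v.nonneg _) (hun v)
      have h2 := mul_le_mul (hle v k) (h l) (v.nonneg _) (hun v)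
      linarith
    refine ciSup_le fun i => ?_
    fin_cases i <;> exact key _ _ _ _
  have nonarch : ∀ v ∈ nonarchAbsVal (K := K), ⨆ i, v (w i) ≤
      (⨆ i, v (u i)) * (⨆ i, v (X i)) ^ (N + 1) := by
    intro v hv
    have hv := AdmissibleAbsValues.isNonarchimedean v hv
    have h := fun i => (hb v _ (hm1 v) (le_sup3 (fun i => v (X i))) i).2 hv
    have key : ∀ i j k l, v (u i * g j - u k * g l) ≤ 
        (⨆ i, v (u i)) * (⨆ i, v (X i)) ^ (N + 1) := by
      intro i j k l
      rw [sub_eq_add_neg]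
      refine (hv _ _).trans ?_
      rw [map_neg_eq_map, map_mul, map_mul]
      exact max_le (mul_le_mul (hle v i) (h j) (v.nonneg _) (hun v))
        (mul_le_mul (hle v k) (h l) (v.nonneg _) (hun v))
    refine ciSup_le fun i => ?_
    fin_cases i <;> exact key _ _ _ _
  have A : (archAbsVal.map fun v : AbsoluteValue K ℝ ↦ ⨆ i, v (w i)).prod ≤
      (2 * 64 ^ (N + 1)) ^ totalWeight K * (archAbsVal.map fun v : AbsoluteValue K ℝ ↦ ⨆ i, v (u i)).prod *
       (archAbsVal.map fun v : AbsoluteValue K ℝ ↦ ⨆ i, v (X i)).prod ^ (N + 1) := by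
    refine (Multiset.prod_map_le_prod_map₀ _ _ (fun v _ => hwn v) (fun v _ => arch v)).trans ?_
    rw [Multiset.prod_map_mul, Multiset.prod_map_mul, Multiset.prod_map_pow, Multiset.map_const',
      Multiset.prod_replicate]
    rfl
  have B : (∏ᶠ v : nonarchAbsVal (K := K), ⨆ i, v.val (w i)) ≤
      (∏ᶠ v : nonarchAbsVal (K := K), ⨆ i, v.val (u i)) *
      (∏ᶠ v : nonarchAbsVal (K := K), ⨆ i, v.val (X i)) ^ (N + 1) := by
    have hp : (fun v : nonarchAbsVal (K := K) ↦ (⨆ i, v.val (X i)) ^ (N + 1)).HasFiniteMulSupport :=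
      (finsupp3 hX).pow _
    rw [finprod_pow (finsupp3 hX), ← finprod_mul_distrib (finsupp3 hu) hp]
    exact finprod_le_finprod (finsupp3 hwi) (fun v => hwn v.val)
      ((finsupp3 hu).mul hp) (fun v => nonarch v.val v.prop)
  refine (mul_le_mul A B (finprod_nonneg fun v => hwn v.val) ?_).trans (le_of_eq (by ring))
  have n1 : 0 ≤ (archAbsVal.map fun v : AbsoluteValue K ℝ ↦ ⨆ i, v (u i)).prod :=
    Multiset.prod_map_nonneg fun v _ => hun v
  have n2 : 0 ≤ (archAbsVal.map fun v : AbsoluteValue K ℝ ↦ ⨆ i, v (X i)).prod :=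
    Multiset.prod_map_nonneg fun v _ => hxn v
  positivity

end Hgt
end SUnit

namespace SUnit
section Fin
open Height Height.AdmissibleAbsValues Function
variable {K : Type*} [Field K] [AdmissibleAbsValues K]

lemma arch_le {v : AbsoluteValue K ℝ} (hv : v ∈ archAbsVal (K := K)) (y : K) :
    v y ≤ mulHeight₁ y := by
  rw [mulHeight₁_eq]
  have h1 : max (v y) 1 ≤ (archAbsVal.map fun v : AbsoluteValue K ℝ ↦ max (v y) 1).prod := by
    obtain ⟨t, ht⟩ := Multiset.exists_cons_of_mem hv
    rw [ht, Multiset.map_cons, Multiset.prod_cons]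
    exact le_mul_of_one_le_right (by positivity) (Multiset.one_le_prod_map fun _ _ ↦ le_max_right ..)
  have h2 : 1 ≤ ∏ᶠ v : nonarchAbsVal (K := K), max (v.val y) 1 := one_le_finprod fun _ ↦ le_max_right ..
  refine (le_max_left _ 1).trans (h1.trans (le_mul_of_one_le_right ?_ h2))
  exact (by positivity : (0:ℝ) ≤ max (v y) 1).trans h1

lemma nonarch_le (v : nonarchAbsVal (K := K)) (y : K) :
    v.val y ≤ mulHeight₁ y := by
  classical
  rcases eq_or_ne y 0 with rfl | hy
  · simp
  rw [mulHeight₁_eq]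
  have h1 : 1 ≤ (archAbsVal.map fun v : AbsoluteValue K ℝ ↦ max (v y) 1).prod := 
    Multiset.one_le_prod_map fun _ _ ↦ le_max_right ..
  have hfs : (fun v : nonarchAbsVal (K := K) => max (v.val y) 1).HasFiniteMulSupport := by
    refine (hasFiniteMulSupport hy).subset ?_
    intro w hw h
    apply hw
    simp only at h ⊢
    rw [h]; simp
  have h2 : max (v.val y) 1 ≤ ∏ᶠ v : nonarchAbsVal (K := K), max (v.val y) 1 := by
    have hfs' : (mulSupport fun v : nonarchAbsVal (K := K) => max (v.val y) 1).Finite := hfs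
    obtain ⟨T, hT⟩ : ∃ T : Finset (nonarchAbsVal (K := K)), T = hfs'.toFinset := ⟨_, rfl⟩
    rw [finprod_eq_prod_of_mulSupport_subset (s := insert v T) _ (by
      rw [Finset.coe_insert, hT, Set.Finite.coe_toFinset]; exact Set.subset_insert _ _)]
    rw [← Finset.mul_prod_erase _ _ (Finset.mem_insert_self _ _)]
    refine le_mul_of_one_le_right (by positivity) ?_
    calc (1 : ℝ) = ∏ _i ∈ (insert v T).erase v, 1 := by simp
      _ ≤ _ := Finset.prod_le_prod (by simp) (fun _ _ => le_max_right _ _)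
  refine (le_max_left _ 1).trans (h2.trans (le_mul_of_one_le_left ?_ h1))
  exact (by positivity : (0:ℝ) ≤ max (v.val y) 1).trans h2

/-- the projective point attached to a solution -/
def pt (x : K) : Fin 3 → K := ![x, 1 - x, -1]

lemma mulHeight₁_le_pt (x : K) (i : Fin 3) : mulHeight₁ (pt x i) ≤ mulHeight (pt x) := by
  have h := mulHeight_comp_le ![i, 2] (pt x)
  have e : (pt x) ∘ ![i, 2] = ![pt x i, -1] := by
    funext j; fin_cases j <;> simp [pt]
  rw [e, ← mulHeight₁_div_eq_mulHeight, div_neg, div_one, mulHeight₁_neg] at h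
  exact h

lemma abs_log_le (x : K) (i : Fin 3) (hx : pt x i ≠ 0) (v : AbsoluteValue K ℝ)
    (hv : ∀ y, v y ≤ mulHeight₁ y) : |Real.log (v (pt x i))| ≤ Real.log (mulHeight (pt x)) := by
  have h0 : 0 < v (pt x i) := v.pos hx
  rw [abs_le]
  constructor
  · rw [neg_le, ← Real.log_inv, ← map_inv₀]
    apply Real.log_le_log (v.pos (inv_ne_zero hx))
    refine (hv _).trans ?_
    rw [mulHeight₁_inv]
    exact mulHeight₁_le_pt x i
  · exact Real.log_le_log h0 ((hv _).trans (mulHeight₁_le_pt x i))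

lemma mulHeight_le_of_units (S : Finset (nonarchAbsVal (K := K))) (u : Fin 3 → K) (hu : ∀ i, u i ≠ 0)
    (hS : ∀ v ∉ S, ∀ i, v.val (u i) = 1) (B : ℝ)
    (harch : ∀ v ∈ archAbsVal (K := K), ∀ i, v (u i) ≤ B)
    (hnon : ∀ v ∈ S, ∀ i, v.val (u i) ≤ B) : 
    mulHeight u ≤ B ^ (totalWeight K + S.card) := by
  have hu0 : u ≠ 0 := fun h => hu 0 (by simp [h])
  have hun : ∀ v : AbsoluteValue K ℝ, 0 ≤ ⨆ i, v (u i) := fun v => Real.iSup_nonneg fun i => v.nonneg _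
  rw [mulHeight_eq hu0, pow_add]
  have h1 : (archAbsVal.map fun v : AbsoluteValue K ℝ ↦ ⨆ i, v (u i)).prod ≤ B ^ totalWeight K := by
    refine (Multiset.prod_map_le_prod_map₀ _ (fun _ => B) (fun v _ => hun v) 
      (fun v hv => ciSup_le fun i => harch v hv i)).trans ?_
    rw [Multiset.map_const', Multiset.prod_replicate]
    rfl
  have h2 : (∏ᶠ v : nonarchAbsVal (K := K), ⨆ i, v.val (u i)) ≤ B ^ S.card := by
    rw [finprod_eq_prod_of_mulSupport_subset (s := S)]
    · refine (Finset.prod_le_prod (fun v _ => hun v.val) (fun v hv => ciSup_le fun i => hnon v hv i)).trans ?_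
      simp
    · intro v hv
      by_contra h
      apply hv
      simp [hS v h]
  refine mul_le_mul h1 h2 (finprod_nonneg fun v => hun v.val) ?_
  exact (Multiset.prod_map_nonneg fun v _ => hun v).trans h1

theorem sunit_finite_aux [CharZero K] (hN : ∀ B, {x : K | mulHeight₁ x ≤ B}.Finite)
    (S : Finset (nonarchAbsVal (K := K))) :
    {x : K | x ≠ 0 ∧ 1 - x ≠ 0 ∧ ∀ v ∉ S, v.val x = 1 ∧ v.val (1 - x) = 1}.Finite := by
  classical
  set s := {x : K | x ≠ 0 ∧ 1 - x ≠ 0 ∧ ∀ v ∉ S, v.val x = 1 ∧ v.val (1 - x) = 1} with hs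
  let h : K → ℝ := fun x => Real.log (mulHeight (pt x))
  have hpos : ∀ x, 0 ≤ h x := fun x => Real.log_nonneg (one_le_mulHeight _)
  have hN' : ∀ B, {x : K | h x ≤ B}.Finite := by
    intro B
    refine (hN (Real.exp B)).subset fun x hx => ?_
    have h1 := mulHeight₁_le_pt x 0
    have h2 : mulHeight (pt x) ≤ Real.exp B := (Real.log_le_iff_le_exp (mulHeight_pos _)).1 hx
    exact h1.trans h2
  set W := totalWeight K with hW
  set n := W + S.card with hn
  set M : ℕ := 4 * n + 1 with hM
  have hMpos : (0 : ℝ) < M := Nat.cast_pos.2 (by omega)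
  let V : Finset (AbsoluteValue K ℝ) := archAbsVal.toFinset ∪ S.image Subtype.val
  have hV : ∀ v ∈ V, ∀ y, v y ≤ mulHeight₁ y := by
    intro v hv y
    rcases Finset.mem_union.1 hv with hv | hv
    · exact arch_le (Multiset.mem_toFinset.1 hv) y
    · obtain ⟨w, _, rfl⟩ := Finset.mem_image.1 hv
      exact nonarch_le w y
  have hne : ∀ x ∈ s, ∀ i, pt x i ≠ 0 := by
    intro x hx i
    fin_cases i
    · exact hx.1
    · exact hx.2.1
    · simp [pt]
  have hone : ∀ x ∈ s, ∀ v ∉ S, ∀ i, v.val (pt x i) = 1 := by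
    intro x hx v hv i
    fin_cases i
    · exact (hx.2.2 v hv).1
    · exact (hx.2.2 v hv).2
    · simp [pt]
  let f : K → (V × Fin 3 → ℤ) := fun x p => ⌊M * (Real.log (p.1.val (pt x p.2)) / h x)⌋
  have hratio : ∀ x ∈ s, ∀ v ∈ V, ∀ i, |Real.log (v (pt x i)) / h x| ≤ 1 := by
    intro x hx v hv i
    rw [abs_div, abs_of_nonneg (hpos x)]
    exact div_le_one_of_le₀ (abs_log_le x i (hne x hx i) v (hV v hv)) (hpos x)
  apply Set.Finite.of_finite_fibers f
  · refine (Set.Finite.pi' (t := fun _ => Set.Icc (-(M : ℤ)) M) fun _ => Set.finite_Icc _ _).subset ?_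
    rintro _ ⟨x, hx, rfl⟩ ⟨v, i⟩
    have := abs_le.1 (hratio x hx v.1 v.2 i)
    have hM0 : (0 : ℝ) ≤ M := Nat.cast_nonneg _
    refine ⟨Int.le_floor.2 ?_, Int.cast_le.1 ((Int.floor_le _).trans ?_ : (_ : ℝ) ≤ _)⟩
    · push_cast
      nlinarith [this.1]
    · push_cast
      nlinarith [this.2]
  · intro c _
    by_contra hinf
    have hinf : (s ∩ f ⁻¹' {c}).Infinite := hinf
    set C : ℝ := W * Real.log 128 with hC
    have hC0 : 0 ≤ C := mul_nonneg (Nat.cast_nonneg _) (Real.log_nonneg (by norm_num))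
    obtain ⟨x, ⟨hxs, hxc⟩, hxh⟩ := (hinf.sdiff (hN' (4 * C + 1))).nonempty
    simp only [Set.mem_ofPred_eq, not_le] at hxh
    obtain ⟨x', ⟨hxs', hxc'⟩, hxh'⟩ := (hinf.sdiff (hN' ((2 * (4 * n + 5)) * h x))).nonempty
    simp only [Set.mem_ofPred_eq, not_le] at hxh'
    have hh : 0 < h x := by linarith
    have hh' : 0 < h x' := lt_of_le_of_lt (by positivity) hxh'
    set N := ⌊h x' / h x / 2⌋₊ with hNdef
    have hN1 : (N : ℝ) ≤ h x' / h x / 2 := Nat.floor_le (by positivity)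
    have hN2 : h x' / h x / 2 < N + 1 := Nat.lt_floor_add_one _
    have hN3 : 2 * N * h x ≤ h x' := by
      rw [div_div, le_div_iff₀ (by positivity)] at hN1; linarith
    have hN4 : h x' ≤ (2 * N + 2) * h x := by
      rw [div_div, div_lt_iff₀ (by positivity)] at hN2; linarith
    set k := 2 * N + 1 with hk
    let u : Fin 3 → K := fun i => pt x' i / pt x i ^ k
    have hune : ∀ i, u i ≠ 0 := fun i => div_ne_zero (hne _ hxs' i) (pow_ne_zero _ (hne _ hxs i))
    have hptsum : ∀ y : K, pt y 0 + pt y 1 + pt y 2 = 0 := by intro y; simp [pt]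
    have key := height_ineq (pt x) u (hne x hxs) hune (hptsum x) (by simp [pt]) N (by
      rw [← hk]
      have : ∀ i, pt x i ^ k * u i = pt x' i := fun i => 
        mul_div_cancel₀ _ (pow_ne_zero _ (hne _ hxs i))
      rw [this, this, this, hptsum])
    set B : ℝ := h x' / M + h x with hB
    have hub : ∀ v ∈ V, ∀ i, v (u i) ≤ Real.exp B := by
      intro v hv i
      have p1 : 0 < v (pt x i) := v.pos (hne x hxs i)
      have p2 : 0 < v (pt x' i) := v.pos (hne x' hxs' i)
      rw [← Real.log_le_iff_le_exp (v.pos (hune i))]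
      simp only [u, map_div₀, map_pow]
      rw [Real.log_div p2.ne' (pow_pos p1 k).ne', Real.log_pow]
      have e1 : f x (⟨v, hv⟩, i) = f x' (⟨v, hv⟩, i) := by
        rw [show f x = c from hxc, show f x' = c from hxc']
      have e2 := Int.abs_sub_lt_one_of_floor_eq_floor e1
      have r1 := abs_le.1 (hratio x hxs v hv i)
      simp only at e2
      set a := Real.log (v (pt x i)) / h x with ha
      set a' := Real.log (v (pt x' i)) / h x' with ha'
      have la : Real.log (v (pt x i)) = a * h x := (div_mul_cancel₀ _ hh.ne').symm
      have la' : Real.log (v (pt x' i)) = a' * h x' := (div_mul_cancel₀ _ hh'.ne').symm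
      rw [la, la']
      have hM0 := hMpos
      have e3 : a' - a ≤ 1 / M := by
        rw [le_div_iff₀ hM0]
        have := (abs_lt.1 e2).1
        nlinarith
      have e4 : h x' * (a' - a) ≤ h x' / M := by
        rw [div_eq_mul_one_div]
        exact mul_le_mul_of_nonneg_left e3 hh'.le
      have hk' : (k : ℝ) = 2 * N + 1 := by rw [hk]; push_cast; ring
      have e5 : |h x' - k * h x| ≤ h x := by
        rw [abs_le, hk']; constructor <;> linarith
      have e6 : (h x' - k * h x) * a ≤ h x := by
        refine (le_abs_self _).trans ?_
        rw [abs_mul]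
        calc _ ≤ h x * 1 := mul_le_mul e5 (hratio x hxs v hv i) (abs_nonneg _) hh.le
          _ = h x := mul_one _
      rw [hB]
      linarith
    have hHu : mulHeight u ≤ Real.exp B ^ n := by
      apply mulHeight_le_of_units S u hune
      · intro v hv i
        simp only [u, map_div₀, map_pow, hone x hxs v hv, hone x' hxs' v hv, one_pow, div_one]
      · intro v hv i
        exact hub v (Finset.mem_union_left _ (Multiset.mem_toFinset.2 hv)) i
      · intro v hv i
        exact hub v.val (Finset.mem_union_right _ (Finset.mem_image_of_mem _ hv)) i
    have hHlog : Real.log (mulHeight u) ≤ n * B := by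
      rw [Real.log_le_iff_le_exp (mulHeight_pos _), Real.exp_nat_mul]
      exact hHu
    have hlog := Real.log_le_log (pow_pos (mulHeight_pos _) _) key
    rw [Real.log_mul (mul_pos (by positivity) (mulHeight_pos _)).ne' (pow_pos (mulHeight_pos _) _).ne',
      Real.log_mul (by positivity) (mulHeight_pos _).ne', Real.log_pow, Real.log_pow, Real.log_pow,
      Real.log_mul (by norm_num) (by positivity), Real.log_pow] at hlog
    have hx_eq : Real.log (mulHeight (pt x)) = h x := rfl
    rw [hx_eq] at hlog
    have l128 : Real.log 128 = Real.log 2 + Real.log 64 := by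
      rw [← Real.log_mul (by norm_num) (by norm_num)]; norm_num
    have l2 : 0 ≤ Real.log 2 := Real.log_nonneg (by norm_num)
    push_cast at hlog
    rw [← hW] at hlog
    have c1 : (W : ℝ) * (Real.log 2 + (N + 1) * Real.log 64) ≤ (N + 1) * C := by
      rw [hC, l128]
      have : (0 : ℝ) ≤ W * (N * Real.log 2) := by positivity
      nlinarith
    have c2 : (n : ℝ) * (h x' / M) ≤ (N + 1) * h x / 2 := by
      have hM0 := hMpos
      have hMn : 4 * (n : ℝ) ≤ M := by rw [hM]; push_cast; linarith
      rw [mul_div_assoc', div_le_iff₀ hM0]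
      have t1 : (n : ℝ) * h x' ≤ n * ((2 * N + 2) * h x) := by gcongr
      have t2 : 0 ≤ (N + 1) * h x / 2 := by positivity
      have := mul_le_mul_of_nonneg_left hMn t2
      linarith
    have c3 : (4 * (n : ℝ) + 4) * h x < N * h x := by
      linarith
    have c4 : ((N : ℝ) + 1) * C ≤ (N + 1) * (h x / 4) := by
      gcongr; linarith
    have hBn : (n : ℝ) * B = n * (h x' / M) + n * h x := by rw [hB]; ring
    nlinarith
end Fin

theorem sunit_finite (L : Type*) [Field L] [NumberField L] (S : Set (NumberField.FinitePlace L))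
    (hS : S.Finite) :
    {x : L | x ≠ 0 ∧ 1 - x ≠ 0 ∧ ∀ v ∉ S, v x = 1 ∧ v (1 - x) = 1}.Finite := by
  classical
  let S' : Finset (Height.AdmissibleAbsValues.nonarchAbsVal (K := L)) := hS.toFinset
  refine (sunit_finite_aux (NumberField.finite_setOfPred_mulHeight₁_le L) S').subset ?_
  rintro x ⟨h1, h2, h3⟩
  refine ⟨h1, h2, fun v hv => ?_⟩
  exact h3 v (fun h => hv (hS.mem_toFinset.2 h))
end SUnit

namespace SUnit
section Comb

/-- `p` is the only point of its fibre. -/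
def Tot {P : Type*} (φ : P → P) (p : P) : Prop := ∀ q, φ q = φ p → q = p

lemma three_preimages {P : Type*} (φ : P → P) (hs : Function.Surjective φ) (o : P)
    (hT : ∀ p q r, Tot φ p → Tot φ q → Tot φ r → p = q ∨ p = r ∨ q = r)
    (h2 : ¬ ∀ q, φ (φ q) = o ↔ q = o) :
    ∃ x y z, x ≠ y ∧ x ≠ z ∧ y ≠ z ∧ φ (φ (φ (φ x))) = o ∧ φ (φ (φ (φ y))) = o ∧
      φ (φ (φ (φ z))) = o := by
  by_contra hlt
  have hlt : ∀ x y z, φ (φ (φ (φ x))) = o → φ (φ (φ (φ y))) = o →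
      φ (φ (φ (φ z))) = o → x = y ∨ x = z ∨ y = z := by
    intro x y z hx hy hz
    by_contra h
    push Not at h
    exact hlt ⟨x, y, z, h.1, h.2.1, h.2.2, hx, hy, hz⟩
  -- if a level has two points, the next level consists of two total points
  have lift2 : ∀ (A : P → Prop), (∀ x y z, A (φ x) → A (φ y) → A (φ z) → x = y ∨ x = z ∨ y = z) →
      ∀ x y, A x → A y → x ≠ y → ∃ x' y', x' ≠ y' ∧ A (φ x') ∧ A (φ y') ∧ Tot φ x' ∧ Tot φ y' := by
    intro A hA x y hx hy hxy
    obtain ⟨x', rfl⟩ := hs x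
    obtain ⟨y', rfl⟩ := hs y
    have hne : x' ≠ y' := fun h => hxy (by rw [h])
    refine ⟨x', y', hne, hx, hy, fun q hq => ?_, fun q hq => ?_⟩
    · rcases hA q x' y' (by rwa [hq]) hx hy with h | h | h
      · exact h
      · exact absurd (by rw [← hq, h]) hxy
      · exact absurd h hne
    · rcases hA q x' y' (by rwa [hq]) hx hy with h | h | h
      · exact absurd (by rw [← hq, h]) hxy
      · exact h
      · exact absurd h hne
  obtain ⟨p1, hp1⟩ := hs o
  obtain ⟨p2, hp2⟩ := hs p1
  have hp2' : φ (φ p2) = o := by rw [hp2, hp1]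
  by_cases A2 : ∀ q, φ (φ q) = o → q = p2
  · have hp2o : p2 ≠ o := fun h => h2 fun q => ⟨fun hq => (A2 q hq).trans h, fun hq => by
      have h3 := hp2'
      rw [h] at h3
      rw [hq, h3]⟩
    have hp12 : p1 ≠ p2 := by
      intro h
      apply hp2o
      have e : φ p2 = o := by rw [← h]; exact hp1
      rw [← h, ← hp2, e]
    have T2 : Tot φ p2 := fun q hq => A2 q (by rw [hq, hp2'])
    have T1 : Tot φ p1 := by
      intro q hq
      obtain ⟨q', rfl⟩ := hs q
      rw [A2 q' (by rw [hq, hp1]), hp2]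
    obtain ⟨p3, hp3⟩ := hs p2
    by_cases A3 : ∀ q, φ (φ (φ q)) = o → q = p3
    · have T3 : Tot φ p3 := fun q hq => A3 q (by rw [hq, hp3, hp2'])
      rcases hT p1 p2 p3 T1 T2 T3 with h | h | h
      · exact hp12 h
      · apply hp2o; rw [← hp3, ← h, hp1]
      · exact hp12 (hp2.symm.trans ((congrArg φ h).trans hp3))
    · push Not at A3
      obtain ⟨q, hq, hq3⟩ := A3
      obtain ⟨x', y', hne, hx, hy, Tx, Ty⟩ := lift2 (fun z => φ (φ (φ z)) = o) (fun x y z hx hy hz => hlt x y z hx hy hz)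
        q p3 hq (by rw [hp3, hp2']) hq3
      have c1 : p1 = x' ∨ p1 = y' := by
        have a := hT p1 x' y' T1 Tx Ty
        tauto
      have c2 : p2 = x' ∨ p2 = y' := by
        have a := hT p2 x' y' T2 Tx Ty
        tauto
      have e2 : φ (φ (φ (φ p2))) = o := by rcases c2 with h | h <;> rw [h] <;> assumption
      rw [hp2, hp1] at e2
      exact hp2o (A2 o e2).symm
  · push Not at A2
    obtain ⟨q, hq, hq2⟩ := A2
    have hlt3 : ∀ x y z, φ (φ (φ x)) = o → φ (φ (φ y)) = o → φ (φ (φ z)) = o → x = y ∨ x = z ∨ y = z := by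
      intro x y z hx hy hz
      obtain ⟨x, rfl⟩ := hs x
      obtain ⟨y, rfl⟩ := hs y
      obtain ⟨z, rfl⟩ := hs z
      rcases hlt x y z hx hy hz with h | h | h <;> simp [h]
    obtain ⟨x, y, hxy, hx, hy, Tx, Ty⟩ := lift2 (fun z => φ (φ z) = o) hlt3 q p2 hq hp2' hq2
    obtain ⟨x', y', hxy', hx', hy', Tx', Ty'⟩ := lift2 (fun z => φ (φ (φ z)) = o) 
      (fun x y z hx hy hz => hlt x y z hx hy hz) x y hx hy hxy
    have h34 : ∀ q, φ (φ (φ q)) = o ↔ φ (φ (φ (φ q))) = o := by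
      intro q
      have b1 := hT x x' y' Tx Tx' Ty'
      have b2 := hT y x' y' Ty Tx' Ty'
      have b3 := hT x' x y Tx' Tx Ty
      have b4 := hT y' x y Ty' Tx Ty
      constructor
      · intro h
        have b := hlt3 q x y h hx hy
        have : q = x' ∨ q = y' := by grind
        rcases this with h | h <;> rw [h] <;> assumption
      · intro h
        have b := hlt q x' y' h hx' hy'
        have : q = x ∨ q = y := by grind
        rcases this with h | h <;> rw [h] <;> assumption
    have h23 : ∀ q, φ (φ q) = o ↔ φ (φ (φ q)) = o := by
      intro q; obtain ⟨r, rfl⟩ := hs q; exact h34 r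
    have h12 : ∀ q, φ q = o ↔ φ (φ q) = o := by
      intro q; obtain ⟨r, rfl⟩ := hs q; exact h23 r
    have h01 : ∀ q, q = o ↔ φ q = o := by
      intro q; obtain ⟨r, rfl⟩ := hs q; exact h12 r
    exact h2 fun q => ((h01 q).trans (h12 q)).symm
end Comb
end SUnit

namespace SUnit
section Forms

/-- binary form with given coefficients -/
def bform {A : Type*} [CommRing A] (n : ℕ) (a : ℕ → A) (x y : A) : A :=
  ∑ t ∈ Finset.range (n + 1), a t * x ^ (n - t) * y ^ t

lemma bform_smul {A : Type*} [CommRing A] (n : ℕ) (a : ℕ → A) (c x y : A) :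
    bform n a (c * x) (c * y) = c ^ n * bform n a x y := by
  unfold bform
  rw [Finset.mul_sum]
  refine Finset.sum_congr rfl fun t ht => ?_
  have : n = (n - t) + t := by have := Finset.mem_range.1 ht; omega
  rw [mul_pow, mul_pow]
  conv_rhs => rw [this, pow_add]
  simp only [Nat.add_sub_cancel]
  ring

lemma bform_lin {A : Type*} [CommRing A] (n : ℕ) (a a' : ℕ → A) (α β x y : A) :
    β * bform n a x y - α * bform n a' x y = bform n (fun t => β * a t - α * a' t) x y := by
  unfold bform
  rw [Finset.mul_sum, Finset.mul_sum, ← Finset.sum_sub_distrib]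
  exact Finset.sum_congr rfl fun t ht => by ring

lemma aeval_eq_bform {R A : Type*} [CommRing R] [CommRing A] [Algebra R A] (d : ℕ)
    (F : MvPolynomial (Fin 2) R) (hF : F.IsHomogeneous d) (x y : A) :
    MvPolynomial.aeval ![x, y] F =
      bform d (fun t => algebraMap R A (binaryCoeff d F (d - t))) x y := by
  classical
  rw [MvPolynomial.aeval_def, MvPolynomial.eval₂_eq']
  simp only [Fin.prod_univ_two, Matrix.cons_val_zero, Matrix.cons_val_one]
  let e : ℕ → (Fin 2 →₀ ℕ) := fun t => Finsupp.single 0 (d - t) + Finsupp.single 1 t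
  have e0 : ∀ t, e t 0 = d - t := fun t => by simp [e]
  have e1 : ∀ t, e t 1 = t := fun t => by simp [e]
  have hinj : Set.InjOn e (Finset.range (d + 1)) := fun a _ b _ h => by
    rw [← e1 a, ← e1 b, h]
  have hsub : F.support ⊆ (Finset.range (d + 1)).image e := by
    intro m hm
    have := hF (MvPolynomial.mem_support_iff.1 hm)
    rw [Finsupp.weight_apply, Finsupp.sum_fintype _ _ (by simp)] at this
    simp [Fin.sum_univ_two] at this
    refine Finset.mem_image.2 ⟨m 1, Finset.mem_range.2 (by omega), ?_⟩
    ext i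
    fin_cases i
    · simp only [Fin.zero_eta, e0]; omega
    · simp only [Fin.mk_one, e1]
  rw [Finset.sum_subset hsub (fun m _ hm => by
    rw [MvPolynomial.notMem_support_iff.1 hm]; simp), Finset.sum_image hinj]
  refine Finset.sum_congr rfl fun t ht => ?_
  have ht' : d - (d - t) = t := by have := Finset.mem_range.1 ht; omega
  rw [e0, e1]
  simp only [binaryCoeff, ht', e]
  ring

section closed
variable {E : Type*} [Field E] [IsAlgClosed E] 

lemma bform_const (n : ℕ) (a : ℕ → E) (p0 p1 q0 q1 : E)
    (h : ∀ t, bform n a (p0 * t + q0) (p1 * t + q1) ≠ 0) (t : E) :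
    bform n a (p0 * t + q0) (p1 * t + q1) = bform n a q0 q1 := by
  let P : Polynomial E := ∑ t ∈ Finset.range (n + 1), Polynomial.C (a t) *
    (Polynomial.C p0 * Polynomial.X + Polynomial.C q0) ^ (n - t) *
      (Polynomial.C p1 * Polynomial.X + Polynomial.C q1) ^ t
  have hP : ∀ t, P.eval t = bform n a (p0 * t + q0) (p1 * t + q1) := by
    intro t
    simp [P, bform, Polynomial.eval_finset_sum]
  have hdeg : P.degree = 0 := by
    by_contra hd
    obtain ⟨r, hr⟩ := IsAlgClosed.exists_root P hd
    exact h r (by rw [← hP]; exact hr)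
  have hC := Polynomial.eq_C_of_degree_eq_zero hdeg
  have h0 := hP 0
  rw [← hP, hC, Polynomial.eval_C]
  rw [hC, Polynomial.eval_C] at h0
  simpa using h0

lemma bform_exists_zero [CharZero E] (n : ℕ) (hn : n ≠ 0) (a : ℕ → E) :
    ∃ x y, ¬ (x = 0 ∧ y = 0) ∧ bform n a x y = 0 := by
  by_contra hcon
  push Not at hcon
  have h1 := bform_const n a 1 0 0 1 (fun t => hcon _ _ (by simp))
  have h2 := bform_const n a 0 1 1 0 (fun t => hcon _ _ (by simp))
  have h3 := h2 1
  have h4 := h2 2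
  simp only [zero_mul, one_mul, zero_add, add_zero] at h1 h3 h4
  have h5 := h1 (1 / 2)
  have h6 := h1 1
  have h7 := bform_smul n a 2 (1 / 2) 1
  rw [h5, mul_one_div_cancel two_ne_zero, mul_one, h4, ← h6, h3] at h7
  have h8 : bform n a 1 0 ≠ 0 := hcon _ _ (by simp)
  have h9 : (2 : E) ^ n = 1 := by
    have : (2 : E) ^ n * bform n a 1 0 = 1 * bform n a 1 0 := by rw [← h7, one_mul]
    exact mul_right_cancel₀ h8 this
  have h10 : 2 ^ n = 1 := by exact_mod_cast h9
  exact hn ((Nat.pow_eq_one.1 h10).resolve_left (by norm_num))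

lemma bform_unique_zero (n : ℕ) (hn : n ≠ 0) (a : ℕ → E) (p0 p1 : E) (hp : ¬ (p0 = 0 ∧ p1 = 0))
    (hz : bform n a p0 p1 = 0) (hu : ∀ x y, bform n a x y = 0 → p0 * y - p1 * x = 0) :
    ∃ c, c ≠ 0 ∧ ∀ x y, bform n a x y = c * (p0 * y - p1 * x) ^ n := by
  obtain ⟨q0, q1, hq⟩ : ∃ q0 q1, p0 * q1 - p1 * q0 = 1 := by
    by_cases h : p0 = 0
    · have h1 : p1 ≠ 0 := fun h1 => hp ⟨h, h1⟩
      exact ⟨-p1⁻¹, 0, by simp [h1]⟩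
    · exact ⟨0, p0⁻¹, by simp [h]⟩
  have hne : ∀ t, bform n a (p0 * t + q0) (p1 * t + q1) ≠ 0 := by
    intro t ht
    have := hu _ _ ht
    apply one_ne_zero (α := E)
    linear_combination this - hq
  have hc := bform_const n a p0 p1 q0 q1 hne
  refine ⟨bform n a q0 q1, by simpa using hne 0, fun x y => ?_⟩
  set s := p0 * y - p1 * x with hs
  set t := x * q1 - y * q0 with ht
  have hx : x = p0 * t + s * q0 := by rw [hs, ht]; linear_combination -x * hq
  have hy : y = p1 * t + s * q1 := by rw [hs, ht]; linear_combination -y * hq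
  by_cases h0 : s = 0
  · rw [h0, zero_pow hn, mul_zero]
    rw [h0, zero_mul, add_zero] at hx hy
    rw [hx, hy, mul_comm p0, mul_comm p1, bform_smul, hz, mul_zero]
  · have hx' : x = s * (p0 * (t / s) + q0) := by rw [hx]; field_simp
    have hy' : y = s * (p1 * (t / s) + q1) := by rw [hy]; field_simp
    conv_lhs => rw [hx', hy', bform_smul, hc]
    ring
end closed
end Forms
end SUnit

namespace SUnit
section Poles
variable {E : Type*} [Field E]

/-- representative of a point of the projective line -/
def prep : Option E → E × E
  | none => (1, 0)
  | some x => (x, 1)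

open Classical in
/-- the point with given homogeneous coordinates -/
noncomputable def pproj (p : E × E) : Option E := if p.2 = 0 then none else some (p.1 / p.2)

lemma prep_ne (P : Option E) : prep P ≠ 0 := by
  cases P <;> simp [prep, Prod.ext_iff]

lemma pproj_prep (P : Option E) : pproj (prep P) = P := by
  cases P <;> simp [prep, pproj]

/-- the two by two determinant -/
def dt (p q : E × E) : E := p.1 * q.2 - p.2 * q.1

lemma ne_zero_iff' (p : E × E) : p ≠ 0 ↔ ¬ (p.1 = 0 ∧ p.2 = 0) := by
  rw [Ne, Prod.ext_iff]; rfl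

lemma pproj_eq_iff (p q : E × E) (hp : p ≠ 0) (hq : q ≠ 0) :
    pproj p = pproj q ↔ dt p q = 0 := by
  obtain ⟨p0, p1⟩ := p
  obtain ⟨q0, q1⟩ := q
  rw [ne_zero_iff'] at hp hq
  simp only at hp hq
  unfold pproj dt
  by_cases h1 : p1 = 0 <;> by_cases h2 : q1 = 0
  · simp [h1, h2]
  · simp only [h1, if_true, h2, if_false]
    simp only [reduceCtorEq, zero_mul, sub_zero, mul_eq_zero, false_iff]
    tauto
  · simp only [h1, if_true, h2, if_false]
    simp only [reduceCtorEq, mul_zero, zero_sub, neg_eq_zero, mul_eq_zero, false_iff]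
    tauto
  · simp only [h1, h2, if_false, Option.some.injEq]
    rw [div_eq_div_iff h1 h2, sub_eq_zero, mul_comm q0]

lemma pproj_smul (c : E) (hc : c ≠ 0) (p : E × E) :
    pproj (c * p.1, c * p.2) = pproj p := by
  unfold pproj
  by_cases h : p.2 = 0
  · simp [h]
  · simp [h, hc, mul_div_mul_left _ _ hc]

lemma prep_pproj (p : E × E) (hp : p ≠ 0) :
    ∃ c, c ≠ 0 ∧ prep (pproj p) = (c * p.1, c * p.2) := by
  obtain ⟨p0, p1⟩ := p
  rw [ne_zero_iff'] at hp
  simp only at hp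
  unfold pproj
  by_cases h : p1 = 0
  · have : p0 ≠ 0 := fun h0 => hp ⟨h0, h⟩
    exact ⟨p0⁻¹, inv_ne_zero this, by simp [h, prep, this]⟩
  · exact ⟨p1⁻¹, inv_ne_zero h, by simp [h, prep]; field_simp⟩

/-- the homogeneous map -/
def hmap {A : Type*} [CommRing A] (d : ℕ) (a a' : ℕ → A) (p : A × A) : A × A :=
  (bform d a p.1 p.2, bform d a' p.1 p.2)

lemma fermat_no [CharZero E] (d : ℕ) (hd : 2 ≤ d) (α β A γ δ : E) (hA : A ≠ 0) (hγ : γ ≠ 0)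
    (hδ : δ ≠ 0) (h : ∀ v, α * v ^ d + β + A * (γ + δ * v) ^ d = 0) : False := by
  have hP : (Polynomial.C α * Polynomial.X ^ d + Polynomial.C β +
      Polynomial.C A * (Polynomial.C γ + Polynomial.C δ * Polynomial.X) ^ d : Polynomial E) = 0 := by
    apply Polynomial.funext
    intro v
    simpa using h v
  have h1 := congrArg (fun P => (Polynomial.derivative P).eval 0) hP
  simp [Polynomial.derivative_pow, show d - 1 ≠ 0 by omega, show d ≠ 0 by omega] at h1
  tauto

variable [IsAlgClosed E] [CharZero E]

lemma three_poles (d : ℕ) (hd : 2 ≤ d) (a a' a'' : ℕ → E)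
    (hcz : ∀ p, hmap d a a' p = 0 → p = 0)
    (hcomp : ∀ p, (hmap d a a' (hmap d a a' p)).2 = bform (d * d) a'' p.1 p.2)
    (h2 : ¬ ∃ c, ∀ x y, bform (d * d) a'' x y = c * y ^ (d * d)) :
    ∃ x y z : E × E, dt x y ≠ 0 ∧ dt x z ≠ 0 ∧ dt y z ≠ 0 ∧
      ((hmap d a a')^[4] x).2 = 0 ∧ ((hmap d a a')^[4] y).2 = 0 ∧
        ((hmap d a a')^[4] z).2 = 0 := by
  set H := hmap d a a' with hH
  have hne : ∀ p, p ≠ 0 → H p ≠ 0 := fun p hp h => hp (hcz p h)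
  let φ : Option E → Option E := fun P => pproj (H (prep P))
  have hφ : ∀ p, p ≠ 0 → φ (pproj p) = pproj (H p) := by
    intro p hp
    obtain ⟨c, hc, h⟩ := prep_pproj p hp
    simp only [φ, h]
    have : H (c * p.1, c * p.2) = (c ^ d * (H p).1, c ^ d * (H p).2) := by
      simp only [hH, hmap, bform_smul]
    rw [this, pproj_smul _ (pow_ne_zero _ hc)]
  have hpn : ∀ p : E × E, pproj p = none ↔ p.2 = 0 := by
    intro p; unfold pproj; split_ifs with h <;> simp [h]
  have hlin : ∀ (w : E × E) (p : E × E), dt (H p) w =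
      bform d (fun t => w.2 * a t - w.1 * a' t) p.1 p.2 := by
    intro w p
    rw [← bform_lin]; simp only [dt, hH, hmap]; ring
  have hsurj : Function.Surjective φ := by
    intro P
    obtain ⟨x, y, hxy, h0⟩ := bform_exists_zero d (by omega)
      (fun t => (prep P).2 * a t - (prep P).1 * a' t)
    have hq : ((x, y) : E × E) ≠ 0 := by rw [ne_zero_iff']; exact hxy
    refine ⟨pproj (x, y), ?_⟩
    rw [hφ _ hq, ← pproj_prep P, pproj_eq_iff _ _ (hne _ hq) (prep_ne P)]
    rw [hlin]; exact h0
  have hTot : ∀ P, Tot φ P → ∃ c, c ≠ 0 ∧ ∀ z, dt (H z) (H (prep P)) = c * dt (prep P) z ^ d := by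
    intro P hP
    obtain ⟨c, hc, h⟩ := bform_unique_zero d (by omega)
      (fun t => (H (prep P)).2 * a t - (H (prep P)).1 * a' t) (prep P).1 (prep P).2
      ((ne_zero_iff' _).1 (prep_ne P)) (by
        rw [← hlin _ (prep P)]; simp only [dt]; ring) (by
        intro x y hxy
        rw [← hlin _ (x, y)] at hxy
        by_cases h0 : ((x, y) : E × E) = 0
        · rw [Prod.ext_iff] at h0
          simp only [Prod.fst_zero, Prod.snd_zero] at h0
          rw [h0.1, h0.2]; ring
        · rw [← pproj_eq_iff _ _ (hne _ h0) (hne _ (prep_ne P)), ← hφ _ h0] at hxy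
          have := hP _ hxy
          rw [← pproj_prep P, eq_comm, pproj_eq_iff _ _ (prep_ne _) h0] at this
          exact this)
    refine ⟨c, hc, fun z => ?_⟩
    rw [hlin]
    exact h _ _
  have hT : ∀ p q r, Tot φ p → Tot φ q → Tot φ r → p = q ∨ p = r ∨ q = r := by
    intro P Q R hP hQ hR
    by_contra hcon
    push Not at hcon
    obtain ⟨hPQ, hPR, hQR⟩ := hcon
    have key : ∀ P Q, Tot φ Q → P ≠ Q → dt (H (prep P)) (H (prep Q)) ≠ 0 := by
      intro P Q hQ h h0
      rw [← pproj_eq_iff _ _ (hne _ (prep_ne _)) (hne _ (prep_ne _))] at h0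
      exact h (hQ P h0)
    have key2 : ∀ P Q : Option E, P ≠ Q → dt (prep P) (prep Q) ≠ 0 := by
      intro P Q h h0
      rw [← pproj_eq_iff _ _ (prep_ne _) (prep_ne _), pproj_prep, pproj_prep] at h0
      exact h h0
    obtain ⟨c1, hc1, e1⟩ := hTot P hP
    obtain ⟨c2, hc2, e2⟩ := hTot Q hQ
    obtain ⟨c3, hc3, e3⟩ := hTot R hR
    have k12 := key P Q hQ hPQ
    have d12 := key2 P Q hPQ
    have d31 := key2 R P hPR.symm
    have d32 := key2 R Q hQR.symm
    generalize H (prep P) = w1 at *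
    generalize H (prep Q) = w2 at *
    generalize H (prep R) = w3 at *
    generalize prep P = p1 at *
    generalize prep Q = p2 at *
    generalize prep R = p3 at *
    refine fermat_no d hd (dt w2 w3 * c1 * dt p1 p2 ^ d) (dt w3 w1 * c2 * (dt p2 p1) ^ d)
      (dt w1 w2 * c3) (dt p3 p1) (dt p3 p2) (mul_ne_zero k12 hc3) d31 d32 (fun v => ?_)
    have f1 := e1 (p1.1 + v * p2.1, p1.2 + v * p2.2)
    have f2 := e2 (p1.1 + v * p2.1, p1.2 + v * p2.2)
    have f3 := e3 (p1.1 + v * p2.1, p1.2 + v * p2.2)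
    generalize H (p1.1 + v * p2.1, p1.2 + v * p2.2) = z at *
    have g1 : dt p1 (p1.1 + v * p2.1, p1.2 + v * p2.2) = dt p1 p2 * v := by
      simp only [dt]; ring
    have g2 : dt p2 (p1.1 + v * p2.1, p1.2 + v * p2.2) = dt p2 p1 := by
      simp only [dt]; ring
    have g3 : dt p3 (p1.1 + v * p2.1, p1.2 + v * p2.2) = dt p3 p1 + dt p3 p2 * v := by
      simp only [dt]; ring
    rw [g1, mul_pow] at f1
    rw [g2] at f2
    rw [g3] at f3
    have hz : dt w2 w3 * dt z w1 + dt w3 w1 * dt z w2 + dt w1 w2 * dt z w3 = 0 := by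
      simp only [dt]; ring
    rw [f1, f2, f3] at hz
    rw [← hz]; ring
  have h2' : ¬ ∀ q, φ (φ q) = none ↔ q = none := by
    intro hall
    apply h2
    have hall' : ∀ p : E × E, p ≠ 0 → ((H (H p)).2 = 0 ↔ p.2 = 0) := by
      intro p hp
      have := hall (pproj p)
      rwa [hφ _ hp, hφ _ (hne _ hp), hpn, hpn] at this
    obtain ⟨c, hc, h⟩ := bform_unique_zero (d * d) (by positivity) a'' 1 0 (by simp) (by
      rw [← hcomp (1, 0)]
      exact (hall' (1, 0) (by simp)).2 rfl) (by
        intro x y hxy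
        rw [← hcomp (x, y)] at hxy
        by_cases h0 : ((x, y) : E × E) = 0
        · rw [Prod.ext_iff] at h0
          simp only [Prod.fst_zero, Prod.snd_zero] at h0
          rw [h0.1, h0.2]; ring
        · have := (hall' (x, y) h0).1 hxy
          simpa using this)
    exact ⟨c, fun x y => by rw [h]; ring⟩
  obtain ⟨x, y, z, hxy, hxz, hyz, hx, hy, hz⟩ := three_preimages φ hsurj none hT h2'
  have key2 : ∀ P Q : Option E, P ≠ Q → dt (prep P) (prep Q) ≠ 0 := by
    intro P Q h h0
    rw [← pproj_eq_iff _ _ (prep_ne _) (prep_ne _), pproj_prep, pproj_prep] at h0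
    exact h h0
  have h4 : ∀ P, φ (φ (φ (φ P))) = none → (H^[4] (prep P)).2 = 0 := by
    intro P hP
    have n0 := prep_ne P
    have n1 := hne _ n0
    have n2 := hne _ n1
    have n3 := hne _ n2
    rw [← pproj_prep P, hφ _ n0, hφ _ n1, hφ _ n2, hφ _ n3, hpn] at hP
    exact hP
  exact ⟨prep x, prep y, prep z, key2 _ _ hxy, key2 _ _ hxz, key2 _ _ hyz, h4 _ hx, h4 _ hy,
    h4 _ hz⟩
end Poles
end SUnit

namespace SUnit
section Sylv
universe u

lemma row_sum {A : Type*} [CommRing A] (d i : ℕ) (hi : i < d) (c : ℕ → A) (x y : A) :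
    ∑ j : Fin (2 * d), (if i ≤ (j : ℕ) ∧ (j : ℕ) ≤ i + d then c (d - ((j : ℕ) - i)) else 0) *
      (x ^ (2 * d - 1 - (j : ℕ)) * y ^ (j : ℕ)) =
    x ^ (d - 1 - i) * y ^ i * bform d (fun t => c (d - t)) x y := by
  rw [Fin.sum_univ_eq_sum_range (fun j => (if i ≤ j ∧ j ≤ i + d then c (d - (j - i)) else 0) *
      (x ^ (2 * d - 1 - j) * y ^ j))]
  simp only [ite_mul, zero_mul]
  rw [← Finset.sum_filter]
  have : (Finset.range (2 * d)).filter (fun j => i ≤ j ∧ j ≤ i + d) = Finset.Ico i (i + (d + 1)) := by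
    ext j; simp only [Finset.mem_filter, Finset.mem_range, Finset.mem_Ico]; omega
  rw [this, Finset.sum_Ico_eq_sum_range, bform, Finset.mul_sum, Nat.add_sub_cancel_left]
  refine Finset.sum_congr rfl fun t ht => ?_
  have ht := Finset.mem_range.1 ht
  rw [Nat.add_sub_cancel_left, show 2 * d - 1 - (i + t) = (d - 1 - i) + (d - t) by omega]
  ring

lemma resultant_cert {K : Type u} [Field K] (d : ℕ) (hd : 2 ≤ d) (F G : MvPolynomial (Fin 2) K)
    (hres : binaryResultant d F G ≠ 0) (k : ℕ) (hk : k < 2 * d) :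
    ∃ u u' : ℕ → K, ∀ (A : Type u) [CommRing A] [Algebra K A] (x y : A),
      x ^ (2 * d - 1 - k) * y ^ k =
        bform (d - 1) (fun t => algebraMap K A (u t)) x y *
          bform d (fun t => algebraMap K A (binaryCoeff d F (d - t))) x y +
        bform (d - 1) (fun t => algebraMap K A (u' t)) x y *
          bform d (fun t => algebraMap K A (binaryCoeff d G (d - t))) x y := by
  set M := sylvesterMatrix d F G with hM
  have hdet : IsUnit M.det := isUnit_iff_ne_zero.2 hres
  have hinv := Matrix.nonsing_inv_mul M hdet
  let e : Fin (2 * d) := ⟨k, hk⟩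
  let w : ℕ → K := fun i => if h : i < 2 * d then M⁻¹ e ⟨i, h⟩ else 0
  refine ⟨w, fun i => w (d + i), ?_⟩
  intro A _ _ x y
  have hrow : ∀ i : Fin (2 * d), ∑ j : Fin (2 * d), algebraMap K A (M i j) *
      (x ^ (2 * d - 1 - (j : ℕ)) * y ^ (j : ℕ)) = if (i : ℕ) < d then
        x ^ (d - 1 - i) * y ^ (i : ℕ) *
          bform d (fun t => algebraMap K A (binaryCoeff d F (d - t))) x y else
        x ^ (d - 1 - (i - d)) * y ^ ((i : ℕ) - d) *
          bform d (fun t => algebraMap K A (binaryCoeff d G (d - t))) x y := by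
    intro i
    split_ifs with h
    · rw [← row_sum d i h (fun t => algebraMap K A (binaryCoeff d F t))]
      refine Finset.sum_congr rfl fun j _ => ?_
      simp only [hM, sylvesterMatrix, Matrix.of_apply, h, if_true, apply_ite (algebraMap K A),
        map_zero]
    · rw [← row_sum d (i - d) (by omega) (fun t => algebraMap K A (binaryCoeff d G t))]
      refine Finset.sum_congr rfl fun j _ => ?_
      simp only [hM, sylvesterMatrix, Matrix.of_apply, h, if_false, apply_ite (algebraMap K A),
        map_zero, Nat.sub_add_cancel (not_lt.1 h)]
  have hmain : x ^ (2 * d - 1 - k) * y ^ k = ∑ i : Fin (2 * d), algebraMap K A (M⁻¹ e i) *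
      ∑ j : Fin (2 * d), algebraMap K A (M i j) *
        (x ^ (2 * d - 1 - (j : ℕ)) * y ^ (j : ℕ)) := by
    simp only [Finset.mul_sum]
    rw [Finset.sum_comm]
    have : ∀ j, ∑ i : Fin (2 * d), algebraMap K A (M⁻¹ e i) * (algebraMap K A (M i j) *
        (x ^ (2 * d - 1 - (j : ℕ)) * y ^ (j : ℕ))) = if e = j then
          (x ^ (2 * d - 1 - (j : ℕ)) * y ^ (j : ℕ)) else 0 := by
      intro j
      have h := congrFun (congrFun hinv e) j
      rw [Matrix.mul_apply, Matrix.one_apply] at h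
      simp only [← mul_assoc, ← map_mul]
      simp only [mul_assoc _ (x ^ _) (y ^ _)]
      rw [← Finset.sum_mul, ← map_sum, h]
      split_ifs <;> simp
    simp only [this]
    simp [e]
  rw [hmain]
  simp only [hrow]
  have hw : ∀ i : Fin (2 * d), M⁻¹ e i = w i := fun i => by simp [w]
  simp only [hw]
  rw [Fin.sum_univ_eq_sum_range (fun i => algebraMap K A (w i) * if i < d then
        x ^ (d - 1 - i) * y ^ i *
          bform d (fun t => algebraMap K A (binaryCoeff d F (d - t))) x y else
        x ^ (d - 1 - (i - d)) * y ^ (i - d) *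
          bform d (fun t => algebraMap K A (binaryCoeff d G (d - t))) x y), two_mul,
    Finset.sum_range_add]
  congr 1
  · unfold bform
    rw [Finset.sum_mul, Nat.sub_add_cancel (by omega)]
    refine Finset.sum_congr rfl fun i hi => ?_
    rw [if_pos (Finset.mem_range.1 hi)]; ring
  · unfold bform
    rw [Finset.sum_mul, Nat.sub_add_cancel (by omega)]
    refine Finset.sum_congr rfl fun i hi => ?_
    rw [if_neg (by omega), Nat.add_sub_cancel_left]; ring
end Sylv

section Val
variable {L : Type*} [Field L] {v : AbsoluteValue L ℝ}

lemma v_sub_le (hv : IsNonarchimedean v) (a b : L) : v (a - b) ≤ max (v a) (v b) := by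
  have := hv a (-b)
  rwa [v.map_neg, ← sub_eq_add_neg] at this

lemma bform_le (hv : IsNonarchimedean v) (n : ℕ) (a : ℕ → L) (ha : ∀ t ≤ n, v (a t) ≤ 1)
    (x y : L) (m : ℝ) (hx : v x ≤ m) (hy : v y ≤ m) : v (bform n a x y) ≤ m ^ n := by
  have hm : 0 ≤ m := (v.nonneg x).trans hx
  refine abv_sum_le_of hv _ _ _ (pow_nonneg hm _) fun t ht => ?_
  have ht : t ≤ n := by have := Finset.mem_range.1 ht; omega
  rw [map_mul, map_mul, map_pow, map_pow]
  calc v (a t) * v x ^ (n - t) * v y ^ t ≤ 1 * m ^ (n - t) * m ^ t := by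
        gcongr
        exact ha t ht
    _ = m ^ n := by rw [one_mul, ← pow_add, Nat.sub_add_cancel ht]

lemma cong_mul (hv : IsNonarchimedean v) {a b a' b' : L} (h1 : v a ≤ 1) (h1' : v b' ≤ 1)
    (h : v (a - a') < 1) (h' : v (b - b') < 1) : v (a * b - a' * b') < 1 := by
  have e : a * b - a' * b' = a * (b - b') + (a - a') * b' := by ring
  rw [e]
  refine (hv _ _).trans_lt (max_lt ?_ ?_)
  · rw [map_mul]
    calc v a * v (b - b') ≤ 1 * v (b - b') := by gcongr
      _ < 1 := by rwa [one_mul]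
  · rw [map_mul]
    calc v (a - a') * v b' ≤ v (a - a') * 1 := by gcongr
      _ < 1 := by rwa [mul_one]

lemma v_pow_le (a : L) (h : v a ≤ 1) (n : ℕ) : v (a ^ n) ≤ 1 := by
  rw [map_pow]; exact pow_le_one₀ (v.nonneg _) h

lemma cong_pow (hv : IsNonarchimedean v) {a a' : L} (h1 : v a ≤ 1) (h1' : v a' ≤ 1)
    (h : v (a - a') < 1) (n : ℕ) : v (a ^ n - a' ^ n) < 1 := by
  induction n with
  | zero => simp
  | succ n ih =>
    rw [pow_succ, pow_succ]
    exact cong_mul hv (v_pow_le a h1 n) h1' ih h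

lemma bform_cong (hv : IsNonarchimedean v) (n : ℕ) (a : ℕ → L) (ha : ∀ t ≤ n, v (a t) ≤ 1)
    {x y x' y' : L} (hx : v x ≤ 1) (hy : v y ≤ 1) (hx' : v x' ≤ 1) (hy' : v y' ≤ 1)
    (h : v (x - x') < 1) (h' : v (y - y') < 1) :
    v (bform n a x y - bform n a x' y') < 1 := by
  unfold bform
  rw [← Finset.sum_sub_distrib]
  have hall : ∀ t ∈ Finset.range (n + 1),
      v (a t * x ^ (n - t) * y ^ t - a t * x' ^ (n - t) * y' ^ t) < 1 := by
    intro t ht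
    have ht : t ≤ n := by have := Finset.mem_range.1 ht; omega
    refine cong_mul hv ?_ (v_pow_le _ hy' _) ?_ (cong_pow hv hy hy' h' _)
    · rw [map_mul]; exact mul_le_one₀ (ha t ht) (v.nonneg _) (v_pow_le _ hx _)
    · exact cong_mul hv (ha t ht) (v_pow_le _ hx' _) (by simp) (cong_pow hv hx hx' h _)
  obtain ⟨t0, ht0, hmax⟩ := Finset.exists_max_image (Finset.range (n + 1))
    (fun t => v (a t * x ^ (n - t) * y ^ t - a t * x' ^ (n - t) * y' ^ t)) ⟨0, by simp⟩
  exact (abv_sum_le_of hv _ _ _ (v.nonneg _) hmax).trans_lt (hall t0 ht0)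

/-- sup norm of a pair -/
noncomputable def vm (v : AbsoluteValue L ℝ) (p : L × L) : ℝ := max (v p.1) (v p.2)

lemma vm_smul (c : L) (p : L × L) : vm v (c * p.1, c * p.2) = v c * vm v p := by
  simp only [vm, map_mul]
  rw [mul_max_of_nonneg _ _ (v.nonneg c)]

/-- good reduction: sup norm is raised to the `d`-th power -/
lemma vm_hmap (hv : IsNonarchimedean v) (d : ℕ) (hd : 2 ≤ d) (a a' u u' w w' : ℕ → L)
    (ha : ∀ t ≤ d, v (a t) ≤ 1) (ha' : ∀ t ≤ d, v (a' t) ≤ 1)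
    (hu : ∀ t ≤ d, v (u t) ≤ 1) (hu' : ∀ t ≤ d, v (u' t) ≤ 1)
    (hw : ∀ t ≤ d, v (w t) ≤ 1) (hw' : ∀ t ≤ d, v (w' t) ≤ 1)
    (hx : ∀ x y, x ^ (2 * d - 1) = bform (d - 1) u x y * bform d a x y +
      bform (d - 1) u' x y * bform d a' x y)
    (hy : ∀ x y, y ^ (2 * d - 1) = bform (d - 1) w x y * bform d a x y +
      bform (d - 1) w' x y * bform d a' x y) (p : L × L) :
    vm v (hmap d a a' p) = vm v p ^ d := by
  have h1 : v p.1 ≤ vm v p := le_max_left _ _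
  have h2 : v p.2 ≤ vm v p := le_max_right _ _
  have h0 : 0 ≤ vm v p := (v.nonneg _).trans h1
  apply le_antisymm
  · exact max_le (bform_le hv d a ha _ _ _ h1 h2) (bform_le hv d a' ha' _ _ _ h1 h2)
  · have key : ∀ s s' : ℕ → L, (∀ t ≤ d, v (s t) ≤ 1) → (∀ t ≤ d, v (s' t) ≤ 1) → ∀ z : L,
        z ^ (2 * d - 1) = bform (d - 1) s p.1 p.2 * bform d a p.1 p.2 +
          bform (d - 1) s' p.1 p.2 * bform d a' p.1 p.2 →
        v z ^ (2 * d - 1) ≤ vm v p ^ (d - 1) * vm v (hmap d a a' p) := by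
      intro s s' hs hs' z hz
      rw [← map_pow, hz]
      refine (hv _ _).trans (max_le ?_ ?_)
      · rw [map_mul]
        exact mul_le_mul (bform_le hv _ s (fun t ht => hs t (by omega)) _ _ _ h1 h2)
          (le_max_left _ _) (v.nonneg _) (pow_nonneg h0 _)
      · rw [map_mul]
        exact mul_le_mul (bform_le hv _ s' (fun t ht => hs' t (by omega)) _ _ _ h1 h2)
          (le_max_right _ _) (v.nonneg _) (pow_nonneg h0 _)
    have hm : vm v p ^ (2 * d - 1) ≤ vm v p ^ (d - 1) * vm v (hmap d a a' p) := by
      rcases max_choice (v p.1) (v p.2) with h | h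
      · rw [show vm v p ^ (2 * d - 1) = v p.1 ^ (2 * d - 1) by rw [vm, h]]
        exact key u u' hu hu' _ (hx _ _)
      · rw [show vm v p ^ (2 * d - 1) = v p.2 ^ (2 * d - 1) by rw [vm, h]]
        exact key w w' hw hw' _ (hy _ _)
    rcases h0.eq_or_lt with h | h
    · rw [← h, zero_pow (by omega)]
      exact (v.nonneg _).trans (le_max_left _ _)
    · rw [show 2 * d - 1 = (d - 1) + d by omega, pow_add] at hm
      exact le_of_mul_le_mul_left hm (pow_pos h _)

lemma hmap_smul {A : Type*} [CommRing A] (d : ℕ) (a a' : ℕ → A) (c : A) (p : A × A) :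
    hmap d a a' (c * p.1, c * p.2) =
      (c ^ d * (hmap d a a' p).1, c ^ d * (hmap d a a' p).2) := by
  simp only [hmap, bform_smul]

lemma hmap_iter_smul {A : Type*} [CommRing A] (d : ℕ) (a a' : ℕ → A) (n : ℕ) (c : A) (p : A × A) :
    (hmap d a a')^[n] (c * p.1, c * p.2) =
      (c ^ (d ^ n) * ((hmap d a a')^[n] p).1, c ^ (d ^ n) * ((hmap d a a')^[n] p).2) := by
  induction n generalizing c p with
  | zero => simp
  | succ n ih =>
    rw [Function.iterate_succ_apply, Function.iterate_succ_apply, hmap_smul, ih, ← pow_mul,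
      pow_succ, mul_comm d]

lemma vm_iter (d : ℕ) (a a' : ℕ → L)
    (hgood : ∀ p, vm v (hmap d a a' p) = vm v p ^ d) (n : ℕ) (p : L × L) :
    vm v ((hmap d a a')^[n] p) = vm v p ^ (d ^ n) := by
  induction n generalizing p with
  | zero => simp
  | succ n ih => rw [Function.iterate_succ_apply, ih, hgood, ← pow_mul, pow_succ, mul_comm d]

lemma iter_cong (hv : IsNonarchimedean v) (d : ℕ) (a a' : ℕ → L)
    (ha : ∀ t ≤ d, v (a t) ≤ 1) (ha' : ∀ t ≤ d, v (a' t) ≤ 1) (n : ℕ) (p q : L × L)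
    (hp : vm v p ≤ 1) (hq : vm v q ≤ 1) (h : v (p.1 - q.1) < 1) (h' : v (p.2 - q.2) < 1) :
    v (((hmap d a a')^[n] p).2 - ((hmap d a a')^[n] q).2) < 1 := by
  induction n generalizing p q with
  | zero => simpa using h'
  | succ n ih =>
    rw [Function.iterate_succ_apply, Function.iterate_succ_apply]
    have p1 := (le_max_left _ _).trans hp
    have p2 := (le_max_right _ _).trans hp
    have q1 := (le_max_left _ _).trans hq
    have q2 := (le_max_right _ _).trans hq
    refine ih _ _ (max_le ?_ ?_) (max_le ?_ ?_) (bform_cong hv d a ha p1 p2 q1 q2 h h')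
      (bform_cong hv d a' ha' p1 p2 q1 q2 h h')
    · simpa [hmap] using bform_le hv d a ha _ _ 1 p1 p2
    · simpa [hmap] using bform_le hv d a' ha' _ _ 1 p1 p2
    · simpa [hmap] using bform_le hv d a ha _ _ 1 q1 q2
    · simpa [hmap] using bform_le hv d a' ha' _ _ 1 q1 q2

/-- if `p` is primitive and its iterate has unit second coordinate, it does not meet a pole -/
lemma dt_unit (hv : IsNonarchimedean v) (d : ℕ) (a a' : ℕ → L)
    (ha : ∀ t ≤ d, v (a t) ≤ 1) (ha' : ∀ t ≤ d, v (a' t) ≤ 1) (n : ℕ) (p r : L × L)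
    (hp : vm v p = 1) (hr : vm v r = 1) (hrn : ((hmap d a a')^[n] r).2 = 0)
    (hpn : v ((hmap d a a')^[n] p).2 = 1) : v (dt r p) = 1 := by
  have p1 : v p.1 ≤ 1 := (le_max_left _ _).trans hp.le
  have p2 : v p.2 ≤ 1 := (le_max_right _ _).trans hp.le
  have r1 : v r.1 ≤ 1 := (le_max_left _ _).trans hr.le
  have r2 : v r.2 ≤ 1 := (le_max_right _ _).trans hr.le
  have hle : v (dt r p) ≤ 1 := by
    refine (v_sub_le hv _ _).trans (max_le ?_ ?_)
    · rw [map_mul]; exact mul_le_one₀ r1 (v.nonneg _) p2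
    · rw [map_mul]; exact mul_le_one₀ r2 (v.nonneg _) p1
  refine le_antisymm hle (not_lt.1 fun hlt => ?_)
  -- `p ≡ l r` for some integral `l`
  obtain ⟨l, hl, e1, e2⟩ : ∃ l, v l ≤ 1 ∧ v (p.1 - l * r.1) < 1 ∧ v (p.2 - l * r.2) < 1 := by
    rcases max_choice (v r.1) (v r.2) with h | h
    · have hr1 : v r.1 = 1 := by rw [← h]; exact hr
      have hr0 : r.1 ≠ 0 := fun h0 => by simp [h0] at hr1
      refine ⟨p.1 / r.1, by rw [map_div₀, hr1, div_one]; exact p1, ?_, ?_⟩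
      · rw [div_mul_cancel₀ _ hr0, sub_self, map_zero]; exact one_pos
      · have : p.2 - p.1 / r.1 * r.2 = dt r p / r.1 := by
          unfold dt; field_simp
        rw [this, map_div₀, hr1, div_one]; exact hlt
    · have hr1 : v r.2 = 1 := by rw [← h]; exact hr
      have hr0 : r.2 ≠ 0 := fun h0 => by simp [h0] at hr1
      refine ⟨p.2 / r.2, by rw [map_div₀, hr1, div_one]; exact p2, ?_, ?_⟩
      · have : p.1 - p.2 / r.2 * r.1 = -(dt r p / r.2) := by
          unfold dt; field_simp; ring
        rw [this, v.map_neg, map_div₀, hr1, div_one]; exact hlt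
      · rw [div_mul_cancel₀ _ hr0, sub_self, map_zero]; exact one_pos
  have := iter_cong hv d a a' ha ha' n p (l * r.1, l * r.2) hp.le (by
    rw [vm_smul, hr, mul_one]; exact hl) e1 e2
  rw [hmap_iter_smul, hrn] at this
  simp only [mul_zero, sub_zero] at this
  exact this.ne hpn

/-- The form of the previous lemma used in the application. -/
lemma dt_val (hv : IsNonarchimedean v) (d : ℕ) (a a' : ℕ → L)
    (ha : ∀ t ≤ d, v (a t) ≤ 1) (ha' : ∀ t ≤ d, v (a' t) ≤ 1)
    (hgood : ∀ p, vm v (hmap d a a' p) = vm v p ^ d) (n : ℕ) (b : L) (r : L × L)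
    (hr : vm v r = 1) (hrn : ((hmap d a a')^[n] r).2 = 0)
    (hb0 : ((hmap d a a')^[n] (b, 1)).2 ≠ 0)
    (hb : v (((hmap d a a')^[n] (b, 1)).1 / ((hmap d a a')^[n] (b, 1)).2) ≤ 1) :
    v (dt r (b, 1)) = max (v b) 1 := by
  have hit := vm_iter d a a' hgood n (b, 1)
  have hpos : 0 < v ((hmap d a a')^[n] (b, 1)).2 := v.pos hb0
  have h2 : v ((hmap d a a')^[n] (b, 1)).2 = vm v (b, 1) ^ d ^ n := by
    rw [← hit, vm, eq_comm]
    apply max_eq_right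
    rw [map_div₀, div_le_one hpos] at hb
    exact hb
  have hvm : vm v (b, 1) = max (v b) 1 := by simp [vm]
  obtain ⟨c, hc⟩ : ∃ c : L, v c = max (v b) 1 := by
    rcases max_choice (v b) 1 with h | h
    · exact ⟨b, h.symm⟩
    · exact ⟨1, by rw [h, map_one]⟩
  have hmpos : 0 < max (v b) 1 := lt_max_of_lt_right one_pos
  have hc0 : c ≠ 0 := fun h => by rw [h, map_zero] at hc; exact hmpos.ne hc
  have := dt_unit hv d a a' ha ha' n (c⁻¹ * (b, (1 : L)).1, c⁻¹ * (b, (1 : L)).2) r (by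
    rw [vm_smul, map_inv₀, hvm, hc, inv_mul_cancel₀ hmpos.ne']) hr hrn (by
    rw [hmap_iter_smul, map_mul, h2, hvm, map_pow, map_inv₀, hc, ← mul_pow,
      inv_mul_cancel₀ hmpos.ne', one_pow])
  have e : dt r (c⁻¹ * (b, (1 : L)).1, c⁻¹ * (b, (1 : L)).2) = c⁻¹ * dt r (b, 1) := by
    unfold dt; ring
  rw [e, map_mul, map_inv₀, hc, inv_mul_eq_one₀ hmpos.ne'] at this
  exact this.symm
end Val
end SUnit

namespace SUnit
section Red
open NumberField IsDedekindDomain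

lemma fin_ne_one {L : Type*} [Field L] [NumberField L] (x : L) (hx : x ≠ 0) :
    {v : FinitePlace L | v.val x ≠ 1}.Finite :=
  FinitePlace.hasFiniteMulSupport hx

lemma fin_gt_one {L : Type*} [Field L] [NumberField L] (x : L) :
    {v : FinitePlace L | ¬ v.val x ≤ 1}.Finite := by
  by_cases hx : x = 0
  · convert Set.finite_empty
    ext v
    simp [hx]
  · exact (fin_ne_one x hx).subset fun v hv h => hv (le_of_eq h)

lemma fin_vm {L : Type*} [Field L] [NumberField L] (r : L × L) (hr : r ≠ 0) :
    {v : FinitePlace L | vm v.val r ≠ 1}.Finite := by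
  have key : ∀ z : L, z ≠ 0 → (∀ v : FinitePlace L, v.val z ≤ vm v.val r) →
      {v : FinitePlace L | vm v.val r ≠ 1}.Finite := by
    intro z hz hle
    refine ((fin_ne_one z hz).union ((fin_gt_one r.1).union (fin_gt_one r.2))).subset ?_
    intro v hv
    by_contra hcon
    simp only [Set.mem_union, not_or, Set.mem_ofPred_eq, not_not] at hcon
    exact hv (le_antisymm (max_le hcon.2.1 hcon.2.2) (hcon.1 ▸ hle v))
  rw [ne_zero_iff'] at hr
  by_cases h : r.1 = 0
  · exact key r.2 (fun h' => hr ⟨h, h'⟩) fun v => le_max_right _ _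
  · exact key r.1 h fun v => le_max_left _ _

lemma nonarch {L : Type*} [Field L] [NumberField L] (v : FinitePlace L) :
    IsNonarchimedean v.val := fun x y => v.add_le x y

lemma dt_ne {L : Type*} [Field L] (d : ℕ) (a a' : ℕ → L) (n : ℕ) (b : L) (r : L × L) (hr : r ≠ 0)
    (hrn : ((hmap d a a')^[n] r).2 = 0) (hb0 : ((hmap d a a')^[n] (b, 1)).2 ≠ 0) :
    dt r (b, 1) ≠ 0 := by
  intro h
  have h1 : r.1 = r.2 * b := by
    unfold dt at h; simp only at h; linear_combination h
  have h2 : r.2 ≠ 0 := fun h2 => (ne_zero_iff' r).1 hr ⟨by rw [h1, h2, zero_mul], h2⟩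
  have h3 : r = (r.2 * (b, (1 : L)).1, r.2 * (b, (1 : L)).2) := by
    ext
    · exact h1
    · simp
  rw [h3, hmap_iter_smul] at hrn
  simp only [mul_eq_zero] at hrn
  rcases hrn with h | h
  · exact absurd h (pow_ne_zero _ h2)
  · exact hb0 h

theorem finite_over {L : Type*} [Field L] [NumberField L] (d : ℕ) (hd : 2 ≤ d)
    (a a' u u' w w' : ℕ → L)
    (hx : ∀ x y, x ^ (2 * d - 1) = bform (d - 1) u x y * bform d a x y +
      bform (d - 1) u' x y * bform d a' x y)
    (hy : ∀ x y, y ^ (2 * d - 1) = bform (d - 1) w x y * bform d a x y +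
      bform (d - 1) w' x y * bform d a' x y) (n : ℕ)
    (r1 r2 r3 : L × L) (h12 : dt r1 r2 ≠ 0) (h13 : dt r1 r3 ≠ 0) (h23 : dt r2 r3 ≠ 0)
    (e1 : ((hmap d a a')^[n] r1).2 = 0) (e2 : ((hmap d a a')^[n] r2).2 = 0)
    (e3 : ((hmap d a a')^[n] r3).2 = 0) (S0 : Set (FinitePlace L)) (hS0 : S0.Finite) :
    {b : L | ((hmap d a a')^[n] (b, 1)).2 ≠ 0 ∧ ∀ v ∉ S0,
      v.val (((hmap d a a')^[n] (b, 1)).1 / ((hmap d a a')^[n] (b, 1)).2) ≤ 1}.Finite := by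
  have n1 : r1 ≠ 0 := fun h => h12 (by simp [h, dt])
  have n2 : r2 ≠ 0 := fun h => h12 (by simp [h, dt])
  have n3 : r3 ≠ 0 := fun h => h13 (by simp [h, dt])
  have hcoef : ∀ c : ℕ → L, {v : FinitePlace L | ¬ ∀ t ≤ d, v.val (c t) ≤ 1}.Finite := by
    intro c
    refine ((Set.finite_Iic d).biUnion fun t _ => fin_gt_one (c t)).subset ?_
    intro v hv
    simp only [Set.mem_ofPred_eq, not_forall] at hv
    obtain ⟨t, ht, h⟩ := hv
    exact Set.mem_biUnion ht h
  let B := S0 ∪ ({v | ¬ ∀ t ≤ d, v.val (a t) ≤ 1} ∪ ({v | ¬ ∀ t ≤ d, v.val (a' t) ≤ 1} ∪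
    ({v | ¬ ∀ t ≤ d, v.val (u t) ≤ 1} ∪ ({v | ¬ ∀ t ≤ d, v.val (u' t) ≤ 1} ∪
    ({v | ¬ ∀ t ≤ d, v.val (w t) ≤ 1} ∪ ({v | ¬ ∀ t ≤ d, v.val (w' t) ≤ 1} ∪
    ({v | vm v.val r1 ≠ 1} ∪ ({v | vm v.val r2 ≠ 1} ∪ ({v | vm v.val r3 ≠ 1} ∪
    ({v | v.val (dt r1 r2) ≠ 1} ∪ ({v | v.val (dt r1 r3) ≠ 1} ∪
    {v | v.val (dt r2 r3) ≠ 1})))))))))))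
  have hB : B.Finite := hS0.union ((hcoef a).union ((hcoef a').union ((hcoef u).union
    ((hcoef u').union ((hcoef w).union ((hcoef w').union ((fin_vm r1 n1).union
    ((fin_vm r2 n2).union ((fin_vm r3 n3).union ((fin_ne_one _ h12).union
    ((fin_ne_one _ h13).union (fin_ne_one _ h23))))))))))))
  let f : L → L := fun b => -(dt r2 r3 * dt r1 (b, 1)) / (dt r1 r2 * dt r3 (b, 1))
  refine Set.Finite.of_finite_image (f := f) ((sunit_finite L B hB).subset ?_) ?_
  · rintro _ ⟨b, ⟨hb0, hb⟩, rfl⟩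
    have l1 := dt_ne d a a' n b r1 n1 e1 hb0
    have l2 := dt_ne d a a' n b r2 n2 e2 hb0
    have l3 := dt_ne d a a' n b r3 n3 e3 hb0
    have hden : dt r1 r2 * dt r3 (b, 1) ≠ 0 := mul_ne_zero h12 l3
    have hone : 1 - f b = (dt r1 r3 * dt r2 (b, 1)) / (dt r1 r2 * dt r3 (b, 1)) := by
      simp only [f]
      rw [eq_div_iff hden, sub_mul, div_mul_cancel₀ _ hden]
      simp only [dt]; ring
    refine ⟨div_ne_zero (neg_ne_zero.2 (mul_ne_zero h23 l1)) hden, ?_, ?_⟩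
    · rw [hone]; exact div_ne_zero (mul_ne_zero h13 l2) hden
    · intro v hvB
      simp only [B, Set.mem_union, not_or, Set.mem_ofPred_eq, not_not] at hvB
      obtain ⟨k0, ka, ka', ku, ku', kw, kw', m1, m2, m3, k12, k13, k23⟩ := hvB
      have hv := nonarch v
      have hgood := vm_hmap hv d hd a a' u u' w w' ka ka' ku ku' kw kw' hx hy
      have hm := fun r hr hrn => dt_val hv d a a' ka ka' hgood n b r hr hrn hb0 (hb v k0)
      have hpos : max (v.val b) 1 ≠ 0 := (lt_max_of_lt_right one_pos).ne'
      rw [hone]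
      change v.val _ = 1 ∧ v.val _ = 1
      simp only [f, map_div₀, AbsoluteValue.map_neg, map_mul, hm r1 m1 e1, hm r2 m2 e2, hm r3 m3 e3,
        k12, k13, k23, one_mul, div_self hpos, and_self]
  · intro b hb b' hb' h
    have l3 := dt_ne d a a' n b r3 n3 e3 hb.1
    have l3' := dt_ne d a a' n b' r3 n3 e3 hb'.1
    simp only [f] at h
    rw [div_eq_div_iff (mul_ne_zero h12 l3) (mul_ne_zero h12 l3')] at h
    have : dt r2 r3 * dt r1 r2 * dt r1 r3 * (b - b') = 0 := by
      simp only [dt] at h ⊢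
      linear_combination -h
    rw [mul_eq_zero] at this
    rcases this with h | h
    · exact absurd h (mul_ne_zero (mul_ne_zero h23 h12) h13)
    · exact sub_eq_zero.1 h

lemma clear_S {K : Type*} [Field K] [NumberField K] (S : Set (HeightOneSpectrum (𝓞 K)))
    (hS : S.Finite) : ∃ s : 𝓞 K, s ≠ 0 ∧ ∀ y ∈ S.integer K, ∃ (n : ℕ) (z : 𝓞 K),
      algebraMap (𝓞 K) K z = algebraMap (𝓞 K) K s ^ n * y := by
  have hex : ∀ P : HeightOneSpectrum (𝓞 K), ∃ s : 𝓞 K, s ∈ P.asIdeal ∧ s ≠ 0 := fun P =>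
    Submodule.exists_mem_ne_zero_of_ne_bot P.ne_bot
  choose g hg hg0 using hex
  refine ⟨∏ P ∈ hS.toFinset, g P, Finset.prod_ne_zero_iff.2 fun P _ => hg0 P, fun y hy => ?_⟩
  set s := ∏ P ∈ hS.toFinset, g P with hs
  have hsP : ∀ P ∈ S, P.valuation K (algebraMap (𝓞 K) K s) < 1 := by
    intro P hP
    rw [HeightOneSpectrum.valuation_lt_one_iff_mem]
    exact Ideal.mem_of_dvd _ (Finset.dvd_prod_of_mem g (hS.mem_toFinset.2 hP)) (hg P)
  have hn : ∀ P : HeightOneSpectrum (𝓞 K), ∃ n : ℕ, P ∈ S →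
      P.valuation K (algebraMap (𝓞 K) K s) ^ n * P.valuation K y ≤ 1 := by
    intro P
    by_cases hP : P ∈ S
    · by_cases hy0 : P.valuation K y = 0
      · exact ⟨0, fun _ => by simp [hy0]⟩
      · obtain ⟨n, hn⟩ := exists_pow_lt₀ (hsP P hP) (Units.mk0 _ (inv_ne_zero hy0))
        refine ⟨n, fun _ => ?_⟩
        rw [Units.val_mk0] at hn
        calc _ ≤ (P.valuation K y)⁻¹ * P.valuation K y := mul_le_mul_left hn.le _
          _ = 1 := inv_mul_cancel₀ hy0
    · exact ⟨0, fun h => absurd h hP⟩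
  choose n hn using hn
  refine ⟨∑ P ∈ hS.toFinset, n P, ?_⟩
  apply HeightOneSpectrum.mem_integers_of_valuation_le_one
  intro P
  have hs1 := P.valuation_le_one (K := K) s
  rw [map_mul, map_pow]
  by_cases hP : P ∈ S
  · refine le_trans (mul_le_mul_left ?_ _) (hn P hP)
    exact pow_le_pow_right_of_le_one' hs1
      (Finset.single_le_sum (fun _ _ => Nat.zero_le _) (hS.mem_toFinset.2 hP))
  · exact mul_le_one' (pow_le_one' hs1 _) (hy P hP)

lemma val_int_le {L : Type*} [Field L] [NumberField L] (v : FinitePlace L) (x : L)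
    (hx : IsIntegral ℤ x) : v.val x ≤ 1 := by
  have := FinitePlace.norm_le_one (K := L) v.maximalIdeal (⟨x, hx⟩ : 𝓞 L)
  rwa [FinitePlace.norm_embedding_eq] at this

lemma transfer {K L : Type*} [Field K] [NumberField K] [Field L] [NumberField L] [Algebra K L]
    (S : Set (HeightOneSpectrum (𝓞 K))) (hS : S.Finite) :
    ∃ S0 : Set (FinitePlace L), S0.Finite ∧ ∀ y ∈ S.integer K, ∀ v ∉ S0,
      v.val (algebraMap K L y) ≤ 1 := by
  obtain ⟨s, hs0, hs⟩ := clear_S S hS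
  have hsL : algebraMap K L (algebraMap (𝓞 K) K s) ≠ 0 := by
    simpa using hs0
  refine ⟨_, fin_ne_one _ hsL, fun y hy v hv => ?_⟩
  simp only [Set.mem_ofPred_eq, not_not] at hv
  obtain ⟨n, z, hz⟩ := hs y hy
  have hzint : IsIntegral ℤ (algebraMap K L (algebraMap (𝓞 K) K z)) :=
    (RingOfIntegers.isIntegral_coe z).map ((algebraMap K L).toIntAlgHom)
  have := val_int_le v _ hzint
  rwa [hz, map_mul, map_mul, map_pow, map_pow, hv, one_pow, one_mul] at this
end Red
end SUnit

namespace SUnit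
section Final
universe u
open MvPolynomial IsDedekindDomain NumberField

lemma map_bform {A B : Type*} [CommRing A] [CommRing B] (f : A →+* B) (n : ℕ) (a : ℕ → A)
    (x y : A) : f (bform n a x y) = bform n (fun t => f (a t)) (f x) (f y) := by
  simp [bform]

lemma map_hmap_iter {A B : Type*} [CommRing A] [CommRing B] (f : A →+* B) (d : ℕ) (a a' : ℕ → A)
    (n : ℕ) (p : A × A) : Prod.map f f ((hmap d a a')^[n] p) =
      (hmap d (fun t => f (a t)) (fun t => f (a' t)))^[n] (Prod.map f f p) := by
  induction n generalizing p with
  | zero => rfl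
  | succ n ih =>
    rw [Function.iterate_succ_apply, Function.iterate_succ_apply, ih]
    congr 1
    simp [hmap, map_bform]

lemma T4_finite {K : Type u} [Field K] [NumberField K]
    (S : Set (HeightOneSpectrum (𝓞 K))) (hS : S.Finite)
    (d : ℕ) (hd : 2 ≤ d)
    (F G : MvPolynomial (Fin 2) K)
    (hF : F.IsHomogeneous d) (hG : G.IsHomogeneous d)
    (hres : binaryResultant d F G ≠ 0)
    (hnotpoly : ¬ ∃ c : K,
        MvPolynomial.bind₁ ![F, G] G = MvPolynomial.C c * (MvPolynomial.X 1) ^ (d * d))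
    (H : K × K → K × K)
    (hH : H = hmap d (fun t => binaryCoeff d F (d - t)) (fun t => binaryCoeff d G (d - t))) :
    {b : K | (H^[4] (b, 1)).2 ≠ 0 ∧ (H^[4] (b, 1)).1 / (H^[4] (b, 1)).2 ∈ S.integer K}.Finite := by
  let E := AlgebraicClosure K
  have : CharZero E := charZero_of_injective_algebraMap (algebraMap K E).injective
  obtain ⟨u, u', hu⟩ := resultant_cert d hd F G hres 0 (by omega)
  obtain ⟨w, w', hw⟩ := resultant_cert d hd F G hres (2 * d - 1) (by omega)
  simp only [Nat.sub_zero, pow_zero, mul_one] at hu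
  simp only [Nat.sub_self, pow_zero, one_mul] at hw
  set Q := MvPolynomial.bind₁ ![F, G] G with hQ
  have hQh : Q.IsHomogeneous (d * d) := by
    refine hG.aeval ![F, G] (fun i => ?_)
    fin_cases i
    · exact hF
    · exact hG
  obtain ⟨x, y, z, hxy, hxz, hyz, hx, hy, hz⟩ := three_poles (E := E) d hd
    (fun t => algebraMap K E (binaryCoeff d F (d - t)))
    (fun t => algebraMap K E (binaryCoeff d G (d - t)))
    (fun t => algebraMap K E (binaryCoeff (d * d) Q (d * d - t)))
    (by
      intro p hp
      have h1 : bform d (fun t => algebraMap K E (binaryCoeff d F (d - t))) p.1 p.2 = 0 :=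
        congrArg Prod.fst hp
      have h2 : bform d (fun t => algebraMap K E (binaryCoeff d G (d - t))) p.1 p.2 = 0 :=
        congrArg Prod.snd hp
      have e1 := hu E p.1 p.2
      have e2 := hw E p.1 p.2
      rw [h1, h2, mul_zero, mul_zero, add_zero] at e1 e2
      exact Prod.ext (pow_eq_zero_iff (by omega) |>.1 e1) (pow_eq_zero_iff (by omega) |>.1 e2))
    (by
      intro p
      rw [← aeval_eq_bform _ _ hQh, hQ, aeval_bind₁]
      simp only [hmap]
      rw [← aeval_eq_bform _ _ hF, ← aeval_eq_bform _ _ hG, ← aeval_eq_bform _ _ hG]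
      congr 2
      funext i
      fin_cases i <;> rfl)
    (by
      rintro ⟨c, hc⟩
      apply hnotpoly
      have hc' : ∀ x y : E, aeval ![x, y] Q = c * y ^ (d * d) := fun x y => by
        rw [aeval_eq_bform _ _ hQh]; exact hc x y
      have hKE : ∀ s t : K, algebraMap K E (eval ![s, t] Q) =
          c * algebraMap K E t ^ (d * d) := by
        intro s t
        rw [← hc' (algebraMap K E s)]
        rw [show eval ![s, t] Q = aeval ![s, t] Q by rw [aeval_eq_eval],
          ← MvPolynomial.aeval_algebraMap_apply]
        congr 2
        funext i
        fin_cases i <;> rfl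
      have hc1 := hKE 0 1
      rw [map_one, one_pow, mul_one] at hc1
      refine ⟨eval ![0, 1] Q, MvPolynomial.funext fun s => ?_⟩
      apply (algebraMap K E).injective
      have hs : s = ![s 0, s 1] := by
        funext i
        fin_cases i <;> rfl
      have := hKE (s 0) (s 1)
      rw [← hs] at this
      rw [this, ← hc1]
      simp)
  let L := IntermediateField.adjoin K ({x.1, x.2, y.1, y.2, z.1, z.2} : Set E)
  have : FiniteDimensional K L := IntermediateField.finiteDimensional_adjoin fun t _ =>
    Algebra.IsIntegral.isIntegral t
  have : CharZero L := charZero_of_injective_algebraMap (algebraMap K L).injective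
  have : FiniteDimensional ℚ L := FiniteDimensional.trans ℚ K L
  have : NumberField L := ⟨⟩
  have hmem : ∀ t ∈ ({x.1, x.2, y.1, y.2, z.1, z.2} : Set E), t ∈ L := fun t ht =>
    IntermediateField.subset_adjoin K _ ht
  let r1 : L × L := (⟨x.1, hmem _ (by simp)⟩, ⟨x.2, hmem _ (by simp)⟩)
  let r2 : L × L := (⟨y.1, hmem _ (by simp)⟩, ⟨y.2, hmem _ (by simp)⟩)
  let r3 : L × L := (⟨z.1, hmem _ (by simp)⟩, ⟨z.2, hmem _ (by simp)⟩)
  let f : L →+* E := algebraMap L E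
  let a : ℕ → L := fun t => algebraMap K L (binaryCoeff d F (d - t))
  let a' : ℕ → L := fun t => algebraMap K L (binaryCoeff d G (d - t))
  have hdt : ∀ p q : L × L, f (dt p q) = dt (Prod.map f f p) (Prod.map f f q) := by
    intro p q; simp [dt]
  have hit : ∀ p : L × L, f ((hmap d a a')^[4] p).2 =
      ((hmap d (fun t => algebraMap K E (binaryCoeff d F (d - t)))
        (fun t => algebraMap K E (binaryCoeff d G (d - t))))^[4] (Prod.map f f p)).2 := by
    intro p
    exact congrArg Prod.snd (map_hmap_iter f d a a' 4 p)
  have hdt0 : ∀ p q : L × L, dt (Prod.map f f p) (Prod.map f f q) ≠ 0 → dt p q ≠ 0 := by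
    intro p q h h0
    rw [← hdt, h0, map_zero] at h
    exact h rfl
  have hit0 : ∀ p : L × L, ((hmap d (fun t => algebraMap K E (binaryCoeff d F (d - t)))
        (fun t => algebraMap K E (binaryCoeff d G (d - t))))^[4] (Prod.map f f p)).2 = 0 →
        ((hmap d a a')^[4] p).2 = 0 := by
    intro p h
    rw [← hit] at h
    exact f.injective (by rw [h, map_zero])
  obtain ⟨S0, hS0, hST⟩ := transfer (K := K) (L := L) S hS
  have hfin := finite_over (L := L) d hd a a' (fun t => algebraMap K L (u t))
    (fun t => algebraMap K L (u' t)) (fun t => algebraMap K L (w t))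
    (fun t => algebraMap K L (w' t)) (hu L) (hw L) 4 r1 r2 r3 (hdt0 r1 r2 hxy) (hdt0 r1 r3 hxz)
    (hdt0 r2 r3 hyz) (hit0 r1 hx) (hit0 r2 hy) (hit0 r3 hz) S0 hS0
  refine Set.Finite.of_finite_image (f := algebraMap K L) (hfin.subset ?_)
    (algebraMap K L).injective.injOn
  rintro _ ⟨b, ⟨hb0, hb⟩, rfl⟩
  have hcomp := map_hmap_iter (algebraMap K L) d (fun t => binaryCoeff d F (d - t))
    (fun t => binaryCoeff d G (d - t)) 4 (b, 1)
  rw [← hH] at hcomp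
  have hcomp' : (hmap d a a')^[4] (algebraMap K L b, 1) =
      Prod.map (algebraMap K L) (algebraMap K L) (H^[4] (b, 1)) := by
    rw [hcomp]; simp [a, a']
  simp only [Set.mem_ofPred_eq, hcomp', Prod.map_fst, Prod.map_snd]
  refine ⟨fun h => hb0 ((algebraMap K L).injective (by rw [h, map_zero])), fun v hv => ?_⟩
  rw [← map_div₀]
  exact hST _ hb v hv
end Final
end SUnit

open MvPolynomial IsDedekindDomain NumberField
/-- Let `K` be a number field and `φ = [F : G] : ℙ¹ → ℙ¹` a rational map of
degree `d ≥ 2` (given by homogeneous `F, G` of degree `d` with nonzero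
resultant) whose second iterate is not a polynomial (its denominator
`G(F, G)` is not a constant multiple of `y^{d²}`).  For `n ≥ 4` let
`T_n = {b ∈ ℙ¹(K) : φⁿ(b) ∈ O_{K,S}}`, where a point is `S`-integral when it is
affine with coordinate in the `S`-integers.  Then `T₄` is finite, and for every
`n ≥ 4` and `b ∈ T_n` the point `φ^{n−4}(b)` lies in `T₄` (a set of bounded
height). -/
theorem integral_iterates_land_in_T4
    (K : Type*) [Field K] [NumberField K]
    (S : Set (HeightOneSpectrum (𝓞 K))) (hS : S.Finite)
    (d : ℕ) (hd : 2 ≤ d)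
    (F G : MvPolynomial (Fin 2) K)
    (hF : F.IsHomogeneous d) (hG : G.IsHomogeneous d)
    (hres : binaryResultant d F G ≠ 0)
    (hnotpoly : ¬ ∃ c : K,
        MvPolynomial.bind₁ ![F, G] G = MvPolynomial.C c * (MvPolynomial.X 1) ^ (d * d))
    (Φ : K × K → K × K)
    (hΦ : Φ = fun p => (MvPolynomial.eval ![p.1, p.2] F, MvPolynomial.eval ![p.1, p.2] G))
    (T : ℕ → Set K)
    (hT : T = fun n => {b : K |
        (Φ^[n] (b, 1)).2 ≠ 0 ∧ (Φ^[n] (b, 1)).1 / (Φ^[n] (b, 1)).2 ∈ S.integer K}) :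
    (T 4).Finite ∧
      ∀ n : ℕ, 4 ≤ n → ∀ b ∈ T n,
        (Φ^[n - 4] (b, 1)).2 = 0 ∨
          (Φ^[n - 4] (b, 1)).1 / (Φ^[n - 4] (b, 1)).2 ∈ T 4 := by
  have hE : Φ = SUnit.hmap d (fun t => binaryCoeff d F (d - t))
      (fun t => binaryCoeff d G (d - t)) := by
    rw [hΦ]
    funext p
    have h1 := SUnit.aeval_eq_bform (A := K) d F hF p.1 p.2
    have h2 := SUnit.aeval_eq_bform (A := K) d G hG p.1 p.2
    rw [MvPolynomial.aeval_eq_eval] at h1 h2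
    exact Prod.ext h1 h2
  refine ⟨?_, ?_⟩
  · rw [hT]
    exact SUnit.T4_finite S hS d hd F G hF hG hres hnotpoly Φ hE
  · intro n hn b hb
    by_cases h0 : (Φ^[n - 4] (b, 1)).2 = 0
    · exact Or.inl h0
    · right
      rw [hT] at hb ⊢
      obtain ⟨hb0, hb1⟩ := hb
      have hit : Φ^[n] (b, 1) = Φ^[4] (Φ^[n - 4] (b, 1)) := by
        rw [← Function.iterate_add_apply, Nat.add_sub_cancel' hn]
      generalize Φ^[n - 4] (b, 1) = q at *
      have hs := SUnit.hmap_iter_smul d (fun t => binaryCoeff d F (d - t))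
        (fun t => binaryCoeff d G (d - t)) 4 q.2 (q.1 / q.2, 1)
      simp only [mul_div_cancel₀ _ h0, mul_one, Prod.mk.eta] at hs
      rw [← hE] at hs
      rw [hit, hs] at hb0 hb1
      simp only at hb0 hb1
      rw [mul_div_mul_left _ _ (pow_ne_zero _ h0)] at hb1
      exact ⟨right_ne_zero_of_mul hb0, hb1⟩
end
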